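/- arXiv:2508.12847 — 3 statements merged into one kernel-verified Lean document; each statement's English description precedes it below -/
import Mathlib

section
/- Lower bound L₃^{r,ε} of Theorem 2: Let (S,X,T) be jointly distributed random variables with values in finite sets, let r satisfy 0 ≤ r < min{I(S;X), H(X)}, and let ε satisfy r ≤ ε ≤ H(S|X) + r. Then there exists a probability space carrying random variables (S',X',T',Y) such that (S',X',T') has the same joint distribution as (S,X,T), Y takes values in a finite set, I(Y;S') ≤ ε, I(X';Y) ≤ r, and I(Y;T') ≥ H(T|(X,S)) + ε − H((X,S)|T). -/
open MeasureTheory ProbabilityTheory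

/-- Shannon entropy (base 2) of a random variable with values in a finite type,
with the convention `0 · log₂ 0 = 0`. -/
noncomputable def ent {Ω α : Type*} [MeasurableSpace Ω] [Fintype α]
    (μ : Measure Ω) (X : Ω → α) : ℝ :=
  ∑ a : α, -((μ (X ⁻¹' {a})).toReal * Real.logb 2 ((μ (X ⁻¹' {a})).toReal))

/-- Conditional Shannon entropy `H(X | Y)` (base 2). -/
noncomputable def condEnt {Ω α β : Type*} [MeasurableSpace Ω] [Fintype α] [Fintype β]
    (μ : Measure Ω) (X : Ω → α) (Y : Ω → β) : ℝ :=
  ent μ (fun ω => (X ω, Y ω)) - ent μ Y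

/-- Mutual information `I(X ; Y)` (base 2). -/
noncomputable def mutInf {Ω α β : Type*} [MeasurableSpace Ω] [Fintype α] [Fintype β]
    (μ : Measure Ω) (X : Ω → α) (Y : Ω → β) : ℝ :=
  ent μ X + ent μ Y - ent μ (fun ω => (X ω, Y ω))

/-- Conditional mutual information `I(X ; Y | Z)` (base 2). -/
noncomputable def condMutInf {Ω α β γ : Type*} [MeasurableSpace Ω] [Fintype α] [Fintype β]
    [Fintype γ] (μ : Measure Ω) (X : Ω → α) (Y : Ω → β) (Z : Ω → γ) : ℝ :=
  ent μ (fun ω => (X ω, Z ω)) + ent μ (fun ω => (Y ω, Z ω))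
    - ent μ (fun ω => (X ω, Y ω, Z ω)) - ent μ Z

section helpers
open Classical

/-- law of `f` under the weights `p` -/
noncomputable def lw {Ω α : Type} [Fintype Ω] (p : Ω → ℝ) (f : Ω → α) (a : α) : ℝ :=
  ∑ ω, if f ω = a then p ω else 0

/-- entropy of `f` under the weights `p` -/
noncomputable def HH {Ω α : Type} [Fintype Ω] [Fintype α] (p : Ω → ℝ) (f : Ω → α) : ℝ :=
  ∑ a : α, -(lw p f a * Real.logb 2 (lw p f a))

lemma lw_sum {Ω α : Type} [Fintype Ω] [Fintype α] (p : Ω → ℝ) (f : Ω → α) (g : α → ℝ) :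
    ∑ a, lw p f a * g a = ∑ ω, p ω * g (f ω) := by
  simp only [lw, Finset.sum_mul]
  rw [Finset.sum_comm]
  refine Finset.sum_congr rfl fun ω _ => ?_
  simp [ite_mul]

lemma lw_nonneg {Ω α : Type} [Fintype Ω] {p : Ω → ℝ} (hp : ∀ ω, 0 ≤ p ω) (f : Ω → α) (a : α) :
    0 ≤ lw p f a := by
  refine Finset.sum_nonneg fun ω _ => ?_
  split_ifs
  · exact hp ω
  · exact le_rfl

lemma lw_total {Ω α : Type} [Fintype Ω] [Fintype α] (p : Ω → ℝ) (f : Ω → α) :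
    ∑ a, lw p f a = ∑ ω, p ω := by
  simpa using lw_sum p f (fun _ => 1)

lemma HH_exp {Ω α : Type} [Fintype Ω] [Fintype α] (p : Ω → ℝ) (f : Ω → α) :
    HH p f = ∑ ω, p ω * (-Real.logb 2 (lw p f (f ω))) := by
  rw [← lw_sum p f (fun a => -Real.logb 2 (lw p f a))]
  simp [HH]

lemma le_lw {Ω α : Type} [Fintype Ω] {p : Ω → ℝ} (hp : ∀ ω, 0 ≤ p ω) (f : Ω → α) (ω : Ω) :
    p ω ≤ lw p f (f ω) := by
  have := Finset.single_le_sum (f := fun ω' => if f ω' = f ω then p ω' else 0) (s := Finset.univ)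
    (fun i _ => by split_ifs; exact hp i; exact le_rfl) (Finset.mem_univ ω)
  simpa [lw] using this

lemma lw_comp_le {Ω α β : Type} [Fintype Ω] {p : Ω → ℝ} (hp : ∀ ω, 0 ≤ p ω)
    (f : Ω → α) (g : α → β) (a : α) :
    lw p f a ≤ lw p (fun ω => g (f ω)) (g a) := by
  refine Finset.sum_le_sum fun ω _ => ?_
  by_cases h : f ω = a
  · simp [h]
  · simp only [h, if_false]
    split_ifs
    · exact hp ω
    · exact le_rfl

lemma HH_comp_le {Ω α β : Type} [Fintype Ω] [Fintype α] [Fintype β] {p : Ω → ℝ}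
    (hp : ∀ ω, 0 ≤ p ω) (f : Ω → α) (g : α → β) :
    HH p (fun ω => g (f ω)) ≤ HH p f := by
  rw [HH_exp, HH_exp]
  refine Finset.sum_le_sum fun ω _ => ?_
  rcases (hp ω).eq_or_lt with h | h
  · simp [← h]
  · refine mul_le_mul_of_nonneg_left (neg_le_neg ?_) h.le
    exact Real.logb_le_logb_of_le (by norm_num) (h.trans_le (le_lw hp f ω)) (lw_comp_le hp f g _)

lemma HH_eq {Ω α β : Type} [Fintype Ω] [Fintype α] [Fintype β] {p : Ω → ℝ}
    (hp : ∀ ω, 0 ≤ p ω) (f : Ω → α) (f' : Ω → β) (g : α → β) (g' : β → α)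
    (h : ∀ ω, g (f ω) = f' ω) (h' : ∀ ω, g' (f' ω) = f ω) :
    HH p f = HH p f' := by
  apply le_antisymm
  · have := HH_comp_le hp f' g'
    simpa [h'] using this
  · have := HH_comp_le hp f g
    simpa [h] using this

lemma HH_sub {Ω α β γ : Type} [Fintype Ω] [Fintype α] [Fintype β] [Fintype γ] {p : Ω → ℝ}
    (hp : ∀ ω, 0 ≤ p ω) (hp1 : ∑ ω, p ω = 1) (A : Ω → α) (B : Ω → β) (C : Ω → γ) :
    HH p B + HH p (fun ω => (A ω, B ω, C ω)) ≤
      HH p (fun ω => (A ω, B ω)) + HH p (fun ω => (B ω, C ω)) := by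
  have hab : ∀ b, ∑ a, lw p (fun ω => (A ω, B ω)) (a, b) = lw p B b := by
    intro b
    simp only [lw]
    rw [Finset.sum_comm]
    refine Finset.sum_congr rfl fun ω _ => ?_
    by_cases h : B ω = b <;> simp [h]
  have hbc : ∀ b, ∑ c, lw p (fun ω => (B ω, C ω)) (b, c) = lw p B b := by
    intro b
    simp only [lw]
    rw [Finset.sum_comm]
    refine Finset.sum_congr rfl fun ω _ => ?_
    by_cases h : B ω = b <;> simp [h]
  set q3 := lw p (fun ω => (A ω, B ω, C ω)) with hq3
  set qab := lw p (fun ω => (A ω, B ω)) with hqab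
  set qbc := lw p (fun ω => (B ω, C ω)) with hqbc
  set qb := lw p B with hqb
  have h3 : ∀ z, 0 ≤ q3 z := lw_nonneg hp _
  have h1 : ∀ z, 0 ≤ qab z := lw_nonneg hp _
  have h2 : ∀ z, 0 ≤ qbc z := lw_nonneg hp _
  have h0 : ∀ z, 0 ≤ qb z := lw_nonneg hp _
  let R : α × β × γ → ℝ := fun z => qab (z.1, z.2.1) * qbc z.2 / qb z.2.1
  have hR : ∑ z, R z = 1 := by
    have : ∑ z, R z = ∑ b, qb b := by
      rw [Fintype.sum_prod_type_right, Fintype.sum_prod_type]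
      refine Finset.sum_congr rfl fun b _ => ?_
      simp only [R]
      simp_rw [← Finset.sum_div, ← Finset.sum_mul, hab, ← Finset.mul_sum, hbc]
      by_cases h : qb b = 0
      · simp [h]
      · field_simp
    rw [this, hqb, lw_total, hp1]
  have hq3R : ∑ z, q3 z * (R z / q3 z) ≤ 1 := by
    rw [← hR]
    refine Finset.sum_le_sum fun z _ => ?_
    by_cases h : q3 z = 0
    · rw [h]; simp only [zero_mul]
      exact div_nonneg (mul_nonneg (h1 _) (h2 _)) (h0 _)
    · rw [mul_div_cancel₀ _ h]
  rw [hq3, lw_sum p (fun ω => (A ω, B ω, C ω)) (fun z => R z / lw p (fun ω => (A ω, B ω, C ω)) z),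
    ← hq3] at hq3R
  have hl2 : 0 < Real.log 2 := Real.log_pos (by norm_num)
  have key : ∑ ω, p ω * (Real.log (qab (A ω, B ω)) + Real.log (qbc (B ω, C ω))
      - Real.log (qb (B ω)) - Real.log (q3 (A ω, B ω, C ω))) ≤ 0 := by
    have : ∑ ω, p ω * (Real.log (qab (A ω, B ω)) + Real.log (qbc (B ω, C ω))
      - Real.log (qb (B ω)) - Real.log (q3 (A ω, B ω, C ω))) ≤
      ∑ ω, (p ω * (R (A ω, B ω, C ω) / q3 (A ω, B ω, C ω)) - p ω) := by
      refine Finset.sum_le_sum fun ω _ => ?_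
      rcases (hp ω).eq_or_lt with h | h
      · simp [← h]
      · have e3 : 0 < q3 (A ω, B ω, C ω) :=
          h.trans_le (le_lw hp (fun ω => (A ω, B ω, C ω)) ω)
        have e1 : 0 < qab (A ω, B ω) := h.trans_le (le_lw hp (fun ω => (A ω, B ω)) ω)
        have e2 : 0 < qbc (B ω, C ω) := h.trans_le (le_lw hp (fun ω => (B ω, C ω)) ω)
        have e0 : 0 < qb (B ω) := h.trans_le (le_lw hp B ω)
        have := Real.log_le_sub_one_of_pos
          (show 0 < R (A ω, B ω, C ω) / q3 (A ω, B ω, C ω) by simp only [R]; positivity)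
        have e : Real.log (R (A ω, B ω, C ω) / q3 (A ω, B ω, C ω)) =
            (Real.log (qab (A ω, B ω)) + Real.log (qbc (B ω, C ω))
      - Real.log (qb (B ω)) - Real.log (q3 (A ω, B ω, C ω))) := by
          simp only [R]
          rw [Real.log_div (by positivity) (by positivity),
            Real.log_div (by positivity) (by positivity),
            Real.log_mul (by positivity) (by positivity)]
        rw [e] at this
        nlinarith
    rw [Finset.sum_sub_distrib, hp1] at this
    linarith
  have fin : HH p B + HH p (fun ω => (A ω, B ω, C ω)) -
      (HH p (fun ω => (A ω, B ω)) + HH p (fun ω => (B ω, C ω))) =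
      (∑ ω, p ω * (Real.log (qab (A ω, B ω)) + Real.log (qbc (B ω, C ω))
      - Real.log (qb (B ω)) - Real.log (q3 (A ω, B ω, C ω)))) / Real.log 2 := by
    simp only [HH_exp]
    rw [← Finset.sum_add_distrib, ← Finset.sum_add_distrib, ← Finset.sum_sub_distrib,
      Finset.sum_div]
    refine Finset.sum_congr rfl fun ω _ => ?_
    simp only [Real.logb, ← hq3, ← hqab, ← hqbc, ← hqb]
    ring
  have := div_nonpos_of_nonpos_of_nonneg key hl2.le
  linarith

/-- product weights -/
def pw {C A : Type} (w : C → ℝ) (p : A → ℝ) : C × A → ℝ := fun z => w z.1 * p z.2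

lemma pw_nonneg {C A : Type} {w : C → ℝ} {p : A → ℝ} (hw : ∀ c, 0 ≤ w c) (hp : ∀ a, 0 ≤ p a)
    (z : C × A) : 0 ≤ pw w p z := mul_nonneg (hw _) (hp _)

lemma pw_sum {C A : Type} [Fintype C] [Fintype A] {w : C → ℝ} {p : A → ℝ}
    (hw : ∑ c, w c = 1) (hp : ∑ a, p a = 1) : ∑ z, pw w p z = 1 := by
  simp [pw, Fintype.sum_prod_type, ← Finset.mul_sum, hp, hw]

lemma HH_mix {C A γ : Type} [Fintype C] [Fintype A] [Fintype γ] (w : C → ℝ) (p : A → ℝ)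
    (hp1 : ∑ a, p a = 1) (F : C → A → γ) :
    HH (pw w p) (fun z => (z.1, F z.1 z.2)) = HH w id + ∑ c, w c * HH p (F c) := by
  have e : ∀ c z, lw (pw w p) (fun z => (z.1, F z.1 z.2)) (c, z) = w c * lw p (F c) z := by
    intro c z
    simp only [lw, pw, Fintype.sum_prod_type, Prod.mk.injEq]
    rw [Finset.sum_eq_single c]
    · simp [Finset.mul_sum]
    · intro b _ hb; simp [hb]
    · simp
  have e0 : ∀ c, lw w id c = w c := by intro c; simp [lw]
  simp only [HH, Fintype.sum_prod_type, e, e0]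
  rw [← Finset.sum_add_distrib]
  refine Finset.sum_congr rfl fun c _ => ?_
  by_cases hc : w c = 0
  · simp [hc]
  · have : ∀ z, -(w c * lw p (F c) z * Real.logb 2 (w c * lw p (F c) z)) =
        lw p (F c) z * (-(w c * Real.logb 2 (w c))) +
          w c * (-(lw p (F c) z * Real.logb 2 (lw p (F c) z))) := by
      intro z
      by_cases hz : lw p (F c) z = 0
      · simp [hz]
      · rw [Real.logb_mul hc hz]; ring
    simp_rw [this]
    rw [Finset.sum_add_distrib, ← Finset.sum_mul, lw_total, hp1, one_mul, Finset.mul_sum]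

lemma HH_fst {C A γ : Type} [Fintype C] [Fintype A] [Fintype γ] (w : C → ℝ) (p : A → ℝ)
    (hp1 : ∑ a, p a = 1) (f : C → γ) : HH (pw w p) (fun z => f z.1) = HH w f := by
  have e : lw (pw w p) (fun z => f z.1) = lw w f := by
    funext c
    simp only [lw, pw, Fintype.sum_prod_type]
    refine Finset.sum_congr rfl fun c' _ => ?_
    split_ifs <;> simp [← Finset.mul_sum, hp1]
  simp [HH, e]

lemma HH_snd {C A γ : Type} [Fintype C] [Fintype A] [Fintype γ] (w : C → ℝ) (p : A → ℝ)
    (hw1 : ∑ a, w a = 1) (f : A → γ) : HH (pw w p) (fun z => f z.2) = HH p f := by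
  have e : lw (pw w p) (fun z => f z.2) = lw p f := by
    funext c
    simp only [lw, pw, Fintype.sum_prod_type_right]
    refine Finset.sum_congr rfl fun c' _ => ?_
    split_ifs <;> simp [← Finset.sum_mul, hw1]
  simp [HH, e]

lemma HH_const {A γ : Type} [Fintype A] [Fintype γ] (p : A → ℝ)
    (hp1 : ∑ a, p a = 1) (c : γ) : HH p (fun _ => c) = 0 := by
  rw [HH_exp]
  simp [lw, hp1]

lemma exists_kernel {A B : Type} [Fintype A] [Fintype B] [Nonempty B] (q : A → B → ℝ)
    (hq : ∀ a b, 0 ≤ q a b) :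
    ∃ k : A → B → ℝ, (∀ a b, 0 ≤ k a b) ∧ (∀ a, ∑ b, k a b = 1) ∧
      ∀ a b, (∑ b', q a b') * k a b = q a b := by
  obtain ⟨b0⟩ := ‹Nonempty B›
  refine ⟨fun a b => if (∑ b', q a b') = 0 then (if b = b0 then 1 else 0)
    else q a b / ∑ b', q a b', ?_, ?_, ?_⟩
  · intro a b
    dsimp only
    split_ifs
    · norm_num
    · norm_num
    · exact div_nonneg (hq _ _) (Finset.sum_nonneg fun _ _ => hq _ _)
  · intro a
    dsimp only
    split_ifs with h
    · simp
    · rw [← Finset.sum_div, div_self h]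
  · intro a b
    dsimp only
    split_ifs with h h'
    · rw [h, zero_mul, (Finset.sum_eq_zero_iff_of_nonneg fun _ _ => hq _ _).1 h b (Finset.mem_univ _)]
    · rw [h, zero_mul, (Finset.sum_eq_zero_iff_of_nonneg fun _ _ => hq _ _).1 h b (Finset.mem_univ _)]
    · rw [mul_div_cancel₀ _ h]

/-- weights of independent family of choices -/
def kw {A B : Type} [Fintype A] (k : A → B → ℝ) : (A → B) → ℝ := fun w => ∏ a, k a (w a)

lemma kw_sum {A B : Type} [DecidableEq A] [Fintype A] [Fintype B] (k : A → B → ℝ) (hk : ∀ a, ∑ b, k a b = 1) :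
    ∑ w, kw k w = 1 := by
  have := Finset.prod_univ_sum (fun _ : A => (Finset.univ : Finset B)) k
  simp only [hk, Finset.prod_const_one, Fintype.piFinset_univ] at this
  simpa [kw] using this.symm

lemma kw_marg {A B : Type} [DecidableEq A] [Fintype A] [Fintype B] (k : A → B → ℝ) (hk : ∀ a, ∑ b, k a b = 1)
    (a : A) (b : B) : (∑ w, if w a = b then kw k w else 0) = k a b := by
  have := Finset.prod_univ_sum (fun _ : A => (Finset.univ : Finset B))
    (fun a' b' => if a' = a then (if b' = b then k a b else 0) else k a' b')
  rw [Finset.prod_eq_single a] at this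
  · simp only [if_true, Finset.sum_ite_eq', Finset.mem_univ, Fintype.piFinset_univ] at this
    rw [this]
    refine Finset.sum_congr rfl fun w _ => ?_
    split_ifs with h
    · refine Finset.prod_congr rfl fun x _ => ?_
      by_cases hx : x = a
      · subst hx; simp [h]
      · simp [hx]
    · symm
      exact Finset.prod_eq_zero (Finset.mem_univ a) (by simp [h])
  · intro a' _ h; simp [h, hk]
  · simp

/-- the measure with given weights -/
noncomputable def mw {Ω : Type} [Fintype Ω] (p : Ω → ℝ) : @Measure Ω ⊤ :=
  ∑ ω, ENNReal.ofReal (p ω) • @Measure.dirac Ω ⊤ ω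

lemma mw_apply {Ω α : Type} [Fintype Ω] {p : Ω → ℝ} (hp : ∀ ω, 0 ≤ p ω) (f : Ω → α) (a : α) :
    mw p (f ⁻¹' {a}) = ENNReal.ofReal (lw p f a) := by
  letI : MeasurableSpace Ω := ⊤
  rw [lw, ENNReal.ofReal_sum_of_nonneg]
  · simp only [mw, Measure.coe_finsetSum, Finset.sum_apply, Measure.smul_apply, smul_eq_mul]
    refine Finset.sum_congr rfl fun ω _ => ?_
    rw [Measure.dirac_apply' _ (by trivial)]
    by_cases h : f ω = a <;> simp [h]
  · intro i _
    split_ifs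
    · exact hp i
    · exact le_rfl

lemma ent_mw {Ω α : Type} [Fintype Ω] [Fintype α] {p : Ω → ℝ} (hp : ∀ ω, 0 ≤ p ω) (f : Ω → α) :
    @ent Ω α ⊤ _ (mw p) f = HH p f := by
  simp only [ent, HH, mw_apply hp, ENNReal.toReal_ofReal (lw_nonneg hp _ _)]

lemma ent_congr {Ω Ω' α β : Type} [MeasurableSpace Ω] [MeasurableSpace Ω'] [Fintype α] [Fintype β]
    [MeasurableSpace β] [MeasurableSingletonClass β] {μ : Measure Ω} {μ' : Measure Ω'}
    {f : Ω → β} {f' : Ω' → β} (h : IdentDistrib f f' μ μ') (g : β → α) :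
    ent μ (fun ω => g (f ω)) = ent μ' (fun ω => g (f' ω)) := by
  simp only [ent]
  refine Finset.sum_congr rfl fun a _ => ?_
  have := h.measure_mem_eq (s := g ⁻¹' {a}) (Set.toFinite _).measurableSet
  simp only [← Set.preimage_comp] at this
  simp only [Function.comp_def] at this
  rw [this]

end helpers

/-- **Lower bound `L₃^{r,ε}` of Theorem 2.** For `0 ≤ r < min{I(S;X), H(X)}` and `r ≤ ε ≤ H(S|X) + r` there is a representation `Y` with `I(Y;S') ≤ ε`, `I(X';Y) ≤ r`, and `I(Y;T') ≥ H(T|(X,S)) + ε − H((X,S)|T)`. -/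
theorem lower_bound_L3re
    {Ω 𝒮 𝒳 𝒯 : Type} [MeasurableSpace Ω] (μ : Measure Ω) [IsProbabilityMeasure μ]
    [Fintype 𝒮] [MeasurableSpace 𝒮] [MeasurableSingletonClass 𝒮]
    [Fintype 𝒳] [MeasurableSpace 𝒳] [MeasurableSingletonClass 𝒳]
    [Fintype 𝒯] [MeasurableSpace 𝒯] [MeasurableSingletonClass 𝒯]
    (S : Ω → 𝒮) (X : Ω → 𝒳) (T : Ω → 𝒯)
    (hS : Measurable S) (hX : Measurable X) (hT : Measurable T)
    (r : ℝ) (hr0 : 0 ≤ r) (hr1 : r < min (mutInf μ S X) (ent μ X))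
    (ε : ℝ) (hε0 : r ≤ ε) (hε1 : ε ≤ condEnt μ S X + r) :
    ∃ (Ω' : Type) (_ : MeasurableSpace Ω') (μ' : Measure Ω')
      (𝒴 : Type) (_ : Fintype 𝒴) (_ : MeasurableSpace 𝒴)
      (S' : Ω' → 𝒮) (X' : Ω' → 𝒳) (T' : Ω' → 𝒯) (Y : Ω' → 𝒴),
      IsProbabilityMeasure μ' ∧
      Measurable S' ∧ Measurable X' ∧ Measurable T' ∧ Measurable Y ∧
      IdentDistrib (fun ω => (S ω, X ω, T ω)) (fun ω => (S' ω, X' ω, T' ω)) μ μ' ∧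
      mutInf μ' Y S' ≤ ε ∧ mutInf μ' X' Y ≤ r ∧
      mutInf μ' Y T' ≥ condEnt μ T (fun ω => (X ω, S ω)) + ε - condEnt μ (fun ω => (X ω, S ω)) T := by
  classical
  have : Nonempty Ω := nonempty_of_isProbabilityMeasure μ
  obtain ⟨ω0⟩ := ‹Nonempty Ω›
  have : Nonempty 𝒮 := ⟨S ω0⟩
  have : Nonempty 𝒯 := ⟨T ω0⟩
  let q : 𝒮 × 𝒳 × 𝒯 → ℝ := fun z => (μ ((fun ω => (S ω, X ω, T ω)) ⁻¹' {z})).toReal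
  have hq : ∀ z, 0 ≤ q z := fun z => ENNReal.toReal_nonneg
  have hSXT : Measurable (fun ω => (S ω, X ω, T ω)) := hS.prodMk (hX.prodMk hT)
  have hq1 : ∑ z, q z = 1 := by
    have h := sum_measureReal_preimage_singleton (μ := μ) (f := fun ω => (S ω, X ω, T ω))
      Finset.univ (fun y _ => hSXT (measurableSet_singleton y))
    simpa [q, Measure.real] using h
  obtain ⟨k, hk0, hk1, hk⟩ := exists_kernel (fun (x : 𝒳) (s : 𝒮) => ∑ t, q (s, x, t))
    (fun x s => Finset.sum_nonneg fun _ _ => hq _)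
  obtain ⟨l, hl0, hl1, hl⟩ := exists_kernel (fun (z : 𝒳 × 𝒮) (t : 𝒯) => q (z.2, z.1, t))
    (fun x s => hq _)
  let pX : 𝒳 → ℝ := fun x => ∑ s, ∑ t, q (s, x, t)
  have hpX0 : ∀ x, 0 ≤ pX x := fun x =>
    Finset.sum_nonneg fun _ _ => Finset.sum_nonneg fun _ _ => hq _
  have hpX1 : ∑ x, pX x = 1 := by
    rw [← hq1]
    simp only [pX, Fintype.sum_prod_type]
    rw [Finset.sum_comm]
  let pA := pw pX (kw k)
  have hkw0 : ∀ w, 0 ≤ kw k w := fun w => Finset.prod_nonneg fun _ _ => hk0 _ _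
  have hkw1 := kw_sum k hk1
  have hlw0 : ∀ w, 0 ≤ kw l w := fun w => Finset.prod_nonneg fun _ _ => hl0 _ _
  have hlw1 := kw_sum l hl1
  have hA0 : ∀ z, 0 ≤ pA z := pw_nonneg hpX0 hkw0
  have hA1 : ∑ z, pA z = 1 := pw_sum hpX1 hkw1
  have hHX : 0 < ent μ X := hr0.trans_lt (hr1.trans_le (min_le_right _ _))
  have hrX : r < ent μ X := hr1.trans_le (min_le_right _ _)
  obtain ⟨α, hα0, hα1, hα⟩ : ∃ α : ℝ, 0 ≤ α ∧ α ≤ 1 ∧ α * ent μ X = r :=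
    ⟨r / ent μ X, div_nonneg hr0 hHX.le, (div_le_one hHX).2 hrX.le, by field_simp⟩
  obtain ⟨β, hβ0, hβ1, hβ⟩ : ∃ β : ℝ, 0 ≤ β ∧ β ≤ 1 ∧ β * condEnt μ S X = ε - r := by
    have h0 : 0 ≤ condEnt μ S X := by linarith
    rcases h0.eq_or_lt with h | h
    · exact ⟨0, le_rfl, zero_le_one, by linarith⟩
    · exact ⟨(ε - r) / condEnt μ S X, div_nonneg (by linarith) h.le,
        (div_le_one h).2 (by linarith), by field_simp⟩
  let bn : ℝ → Bool → ℝ := fun a b => if b then a else 1 - a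
  have hbn0 : ∀ a, 0 ≤ a → a ≤ 1 → ∀ b, 0 ≤ bn a b := by
    intro a h0 h1 b; cases b <;> simp [bn, h0, h1]
  have hbn1 : ∀ a, ∑ b, bn a b = 1 := by intro a; simp [bn]
  let wC : Bool × Bool × (𝒳 × 𝒮 → 𝒯) → ℝ := pw (bn α) (pw (bn β) (kw l))
  have hC0 : ∀ c, 0 ≤ wC c := pw_nonneg (hbn0 α hα0 hα1) (pw_nonneg (hbn0 β hβ0 hβ1) hlw0)
  have hC1 : ∑ c, wC c = 1 := pw_sum (hbn1 α) (pw_sum (hbn1 β) hlw1)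
  let p := pw wC pA
  have hp0 : ∀ z, 0 ≤ p z := pw_nonneg hC0 hA0
  have hp1 : ∑ z, p z = 1 := pw_sum hC1 hA1
  let Ω' := (Bool × Bool × (𝒳 × 𝒮 → 𝒯)) × (𝒳 × (𝒳 → 𝒮))
  letI mΩ' : MeasurableSpace Ω' := ⊤
  let F : (Bool × Bool × (𝒳 × 𝒮 → 𝒯)) → 𝒳 × (𝒳 → 𝒮) → Option 𝒳 × Option (𝒳 → 𝒮) :=
    fun c a => (if c.1 then some a.1 else none, if c.2.1 then some a.2 else none)
  let X' : Ω' → 𝒳 := fun z => z.2.1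
  let S' : Ω' → 𝒮 := fun z => z.2.2 z.2.1
  let T' : Ω' → 𝒯 := fun z => z.1.2.2 (z.2.1, z.2.2 z.2.1)
  let Y : Ω' → (Bool × Bool × (𝒳 × 𝒮 → 𝒯)) × (Option 𝒳 × Option (𝒳 → 𝒮)) :=
    fun z => (z.1, F z.1 z.2)
  have hprob : IsProbabilityMeasure (mw p) := by
    constructor
    have := mw_apply hp0 (fun _ : Ω' => ()) ()
    rw [show (fun _ : Ω' => ()) ⁻¹' {()} = Set.univ by ext; simp] at this
    rw [this]
    simp [lw, hp1]
  have hlaw : ∀ z, lw p (fun ω => (S' ω, X' ω, T' ω)) z = q z := by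
    rintro ⟨s, x, t⟩
    have e1 : ∀ ω : Ω', (if (S' ω, X' ω, T' ω) = (s, x, t) then p ω else 0) =
        (bn α ω.1.1 * bn β ω.1.2.1) * ((if ω.1.2.2 (x, s) = t then kw l ω.1.2.2 else 0) *
          ((if ω.2.1 = x then pX ω.2.1 else 0) * (if ω.2.2 x = s then kw k ω.2.2 else 0))) := by
      rintro ⟨⟨b1, b2, u⟩, x', w⟩
      simp only [S', X', T', p, pw, wC, pA, Prod.mk.injEq]
      by_cases hx : x' = x
      · subst hx
        by_cases hs : w x' = s
        · subst hs
          by_cases ht : u (x', w x') = t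
          · simp [ht]; ring
          · simp [ht]
        · simp [hs]
      · simp [hx]
    have e2 : lw p (fun ω => (S' ω, X' ω, T' ω)) (s, x, t) = ∑ ω : Ω',
        (bn α ω.1.1 * bn β ω.1.2.1) * ((if ω.1.2.2 (x, s) = t then kw l ω.1.2.2 else 0) *
          ((if ω.2.1 = x then pX ω.2.1 else 0) * (if ω.2.2 x = s then kw k ω.2.2 else 0))) := by
      unfold lw
      refine Finset.sum_congr rfl fun ω _ => ?_
      rw [← e1 ω]
      congr
    rw [e2]
    simp only [Ω', Fintype.sum_prod_type, ← Finset.mul_sum, ← Finset.sum_mul, kw_marg l hl1,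
      kw_marg k hk1, hbn1, Finset.sum_ite_eq', Finset.mem_univ, if_true]
    have h1 := hk x s
    have h2 := hl (x, s) t
    simp only at h1 h2
    rw [show pX x * k x s = ∑ t, q (s, x, t) from h1, ← h2]
    ring
  have hid : IdentDistrib (fun ω => (S ω, X ω, T ω)) (fun ω => (S' ω, X' ω, T' ω)) μ (mw p) := by
    refine ⟨hSXT.aemeasurable, (Measurable.of_discrete).aemeasurable, ?_⟩
    refine Measure.ext_of_singleton fun z => ?_
    rw [Measure.map_apply hSXT (measurableSet_singleton z),
      Measure.map_apply Measurable.of_discrete (measurableSet_singleton z),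
      mw_apply hp0, hlaw]
    simp [q]
  have E : ∀ {γ : Type} [Fintype γ] (g : 𝒮 × 𝒳 × 𝒯 → γ),
      ent μ (fun ω => g (S ω, X ω, T ω)) = HH p (fun ω => g (S' ω, X' ω, T' ω)) := by
    intro γ _ g
    rw [ent_congr hid g, ent_mw hp0]
  have EX : ent μ X = HH pA (fun a => a.1) := by
    rw [← HH_snd wC pA hC1]; exact E (fun z => z.2.1)
  have ESX : ent μ (fun ω => (S ω, X ω)) = HH pA (fun a => (a.1, a.2 a.1)) := by
    rw [← HH_snd wC pA hC1]
    refine (E (fun z => (z.1, z.2.1))).trans ?_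
    exact HH_eq hp0 _ _ Prod.swap Prod.swap (fun _ => rfl) (fun _ => rfl)
  have EXS : ent μ (fun ω => (X ω, S ω)) = HH pA (fun a => (a.1, a.2 a.1)) := by
    rw [← HH_snd wC pA hC1]; exact E (fun z => (z.2.1, z.1))
  have EXS' : HH p (fun ω => (X' ω, S' ω)) = HH pA (fun a => (a.1, a.2 a.1)) :=
    HH_snd wC pA hC1 (fun a => (a.1, a.2 a.1))
  have EX' : HH p X' = HH pA (fun a => a.1) := HH_snd wC pA hC1 (fun a => a.1)
  have ET : ent μ T = HH p T' := E (fun z => z.2.2)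
  have ETXS : ent μ (fun ω => (T ω, (X ω, S ω))) = ent μ (fun ω => ((X ω, S ω), T ω)) := by
    rw [E (fun z => (z.2.2, (z.2.1, z.1))), E (fun z => ((z.2.1, z.1), z.2.2))]
    exact HH_eq hp0 _ _ Prod.swap Prod.swap (fun _ => rfl) (fun _ => rfl)
  set hx := HH pA (fun a => a.1) with hhx
  set hxs := HH pA (fun a => (a.1, a.2 a.1)) with hhxs
  set hw := HH pA (fun a => a.2) with hhw
  have hprod : HH pA (fun a => (a.1, a.2)) = hx + hw := by
    have h1 : hx = HH pX id := HH_fst pX (kw k) hkw1 id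
    have h2 : hw = HH (kw k) (fun a => a) := HH_snd pX (kw k) hpX1 (fun a => a)
    have h3 := HH_mix pX (kw k) hkw1 (fun _ a => a)
    rw [← Finset.sum_mul, hpX1] at h3
    rw [h1, h2]; simpa using h3
  have avg : ∀ g : Bool → Bool → ℝ, ∑ c, wC c * g c.1 c.2.1 =
      α * (β * g true true + (1 - β) * g true false) +
      (1 - α) * (β * g false true + (1 - β) * g false false) := by
    intro g
    have e : ∀ b1 b2, ∑ u, wC (b1, b2, u) * g b1 b2 = bn α b1 * (bn β b2 * g b1 b2) := by
      intro b1 b2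
      rw [← Finset.sum_mul]
      simp only [wC, pw, ← Finset.mul_sum, hlw1]
      ring
    simp only [Fintype.sum_prod_type, e]
    simp [bn]
    ring
  have avg' : ∀ (G : Bool × Bool × (𝒳 × 𝒮 → 𝒯) → ℝ) (g : Bool → Bool → ℝ),
      (∀ c, G c = g c.1 c.2.1) → ∑ c, wC c * G c =
      α * (β * g true true + (1 - β) * g true false) +
      (1 - α) * (β * g false true + (1 - β) * g false false) := by
    intro G g h
    rw [← avg g]
    exact Finset.sum_congr rfl fun c _ => by rw [h]
  have HY : HH p Y = HH wC id + (α * hx + β * hw) := by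
    rw [show HH p Y = _ from HH_mix wC pA hA1 F]
    have e : ∀ c, HH pA (F c) = (fun b1 b2 : Bool => if b1 then (if b2 then hx + hw else hx)
        else (if b2 then hw else 0)) c.1 c.2.1 := by
      rintro ⟨b1, b2, u⟩
      cases b1 <;> cases b2 <;> simp only [F, if_true, Bool.false_eq_true, if_false]
      · exact HH_const pA hA1 _
      · exact HH_eq hA0 _ _ (fun z => z.2.getD (fun _ => Classical.arbitrary _))
          (fun z => (none, some z)) (fun _ => rfl) (fun _ => rfl)
      · refine HH_eq hA0 _ _ (fun z => z.1.getD (X ω0))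
          (fun z => (some z, none)) (fun _ => rfl) (fun _ => rfl)
      · rw [← hprod]
        exact HH_eq hA0 _ _
          (fun z => (z.1.getD (X ω0), z.2.getD (fun _ => Classical.arbitrary _)))
          (fun z => (some z.1, some z.2)) (fun _ => rfl) (fun _ => rfl)
    rw [avg' _ (fun b1 b2 : Bool => if b1 then (if b2 then hx + hw else hx)
        else (if b2 then hw else 0)) e]
    simp only [if_true, Bool.false_eq_true, if_false]
    ring
  have HXY : HH p (fun ω => (X' ω, Y ω)) = HH wC id + (hx + β * hw) := by
    rw [HH_eq hp0 (fun ω => (X' ω, Y ω)) (fun ω => (ω.1, (ω.2.1, F ω.1 ω.2)))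
      (fun z => (z.2.1, (z.1, z.2.2))) (fun z => (z.2.1, (z.1, z.2.2)))
      (fun _ => rfl) (fun _ => rfl)]
    rw [show HH p (fun ω => (ω.1, (ω.2.1, F ω.1 ω.2))) = _ from
      HH_mix wC pA hA1 (fun c a => (a.1, F c a))]
    have e : ∀ c, HH pA (fun a => (a.1, F c a)) =
        (fun b1 b2 : Bool => if b2 then hx + hw else hx) c.1 c.2.1 := by
      rintro ⟨b1, b2, u⟩
      cases b2 <;> simp only [if_true, Bool.false_eq_true, if_false]
      · refine HH_eq hA0 _ _ (fun z => z.1)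
          (fun z => (z, (if b1 then some z else none, none))) (fun _ => rfl) (fun _ => by simp [F])
      · rw [← hprod]
        exact HH_eq hA0 _ _
          (fun z => (z.1, z.2.2.getD (fun _ => Classical.arbitrary _)))
          (fun z => (z.1, (if b1 then some z.1 else none, some z.2))) (fun _ => rfl)
          (fun _ => by simp [F])
    rw [avg' _ (fun _ b2 : Bool => if b2 then hx + hw else hx) e]
    simp only [if_true, Bool.false_eq_true, if_false]
    ring
  have HXSY : HH p (fun ω => (X' ω, S' ω, Y ω)) =
      HH wC id + (β * (hx + hw) + (1 - β) * hxs) := by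
    rw [HH_eq hp0 (fun ω => (X' ω, S' ω, Y ω))
      (fun ω => (ω.1, ((ω.2.1, ω.2.2 ω.2.1), F ω.1 ω.2)))
      (fun z => (z.2.2.1, ((z.1, z.2.1), z.2.2.2))) (fun z => (z.2.1.1, z.2.1.2, (z.1, z.2.2)))
      (fun _ => rfl) (fun _ => rfl)]
    rw [show HH p (fun ω => (ω.1, ((ω.2.1, ω.2.2 ω.2.1), F ω.1 ω.2))) = _ from
      HH_mix wC pA hA1 (fun c a => ((a.1, a.2 a.1), F c a))]
    have e : ∀ c, HH pA (fun a => ((a.1, a.2 a.1), F c a)) =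
        (fun b1 b2 : Bool => if b2 then hx + hw else hxs) c.1 c.2.1 := by
      rintro ⟨b1, b2, u⟩
      cases b2 <;> simp only [if_true, Bool.false_eq_true, if_false]
      · refine HH_eq hA0 _ _ (fun z => z.1)
          (fun z => (z, (if b1 then some z.1 else none, none))) (fun _ => rfl)
          (fun _ => by simp [F])
      · rw [← hprod]
        exact HH_eq hA0 _ _
          (fun z => (z.1.1, z.2.2.getD (fun _ => Classical.arbitrary _)))
          (fun z => ((z.1, z.2 z.1), (if b1 then some z.1 else none, some z.2))) (fun _ => rfl)
          (fun _ => by simp [F])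
    rw [avg' _ (fun _ b2 : Bool => if b2 then hx + hw else hxs) e]
    simp only [if_true, Bool.false_eq_true, if_false]
    ring
  have hsub := HH_sub hp0 hp1 X' S' Y
  have hmono : HH p (fun ω => (Y ω, T' ω)) ≤ HH p (fun ω => (X' ω, S' ω, Y ω)) :=
    HH_comp_le hp0 (fun ω => (X' ω, S' ω, Y ω)) (fun z => (z.2.2, z.2.2.1.2.2 (z.1, z.2.1)))
  have hYS : HH p (fun ω => (Y ω, S' ω)) = HH p (fun ω => (S' ω, Y ω)) :=
    HH_eq hp0 _ _ Prod.swap Prod.swap (fun _ => rfl) (fun _ => rfl)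
  have hβ' : β * (hxs - hx) = ε - r := by
    rw [← hβ, condEnt, ESX, EX]
  rw [EX] at hα
  refine ⟨Ω', ⊤, mw p, _, inferInstance, ⊤, S', X', T', Y, hprob, measurable_from_top,
    measurable_from_top, measurable_from_top, (fun _ _ => trivial), hid, ?_, ?_, ?_⟩
  · simp only [mutInf, ent_mw hp0]
    rw [hYS]
    linarith
  · simp only [mutInf, ent_mw hp0]
    linarith
  · simp only [mutInf, condEnt, ETXS]
    rw [EXS, ET]
    simp only [ent_mw hp0]
    linarith
end

section
/- Lower bound L₄^{r,ε} of Theorem 2: Let (S,X,T) be jointly distributed random variables with values in finite sets, let r satisfy 0 ≤ r < min{I(S;X), H(X)}, let ε satisfy r ≤ ε ≤ H(S|X) + r, and set α̃ = ε/(H(S|X)+r). Then there exists a probability space carrying random variables (S',X',T',Y) such that (S',X',T') has the same joint distribution as (S,X,T), Y takes values in a finite set, I(Y;S') ≤ ε, I(X';Y) ≤ r, and I(Y;T') ≥ H(T|(X,S)) + ε − α̃·H((X,S)|T) − 1.06 − log₂((1−α̃)·I((X,S);T) + α̃·min{H(T), H(X,S)} + 5.51). -/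
open MeasureTheory ProbabilityTheory

set_option linter.unusedSectionVars false
section FiniteEntropy

variable {Ω α β γ : Type*} [Fintype Ω] [Fintype α] [Fintype β] [Fintype γ]

open Classical in
/-- Law of a function on a finite weighted space. -/
noncomputable def law {Ω α : Type*} [Fintype Ω] (P : Ω → ℝ) (f : Ω → α) (a : α) : ℝ :=
  ∑ ω, if f ω = a then P ω else 0

/-- Finite entropy in nats. -/
noncomputable def hf {Ω α : Type*} [Fintype Ω] [Fintype α] (P : Ω → ℝ) (f : Ω → α) : ℝ :=
  ∑ a, Real.negMulLog (law P f a)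

lemma law_sum (P : Ω → ℝ) (f : Ω → α) (g : α → ℝ) :
    ∑ a, law P f a * g a = ∑ ω, P ω * g (f ω) := by
  classical
  simp only [law, Finset.sum_mul]
  rw [Finset.sum_comm]
  refine Finset.sum_congr rfl fun ω _ => ?_
  rw [Finset.sum_eq_single (f ω)]
  · simp
  · intro a _ h
    rw [if_neg (fun h' => h h'.symm), zero_mul]
  · simp

lemma law_total (P : Ω → ℝ) (f : Ω → α) : ∑ a, law P f a = ∑ ω, P ω := by
  have := law_sum P f (fun _ => 1)
  simpa using this

lemma law_nonneg (P : Ω → ℝ) (hP : ∀ ω, 0 ≤ P ω) (f : Ω → α) (a : α) : 0 ≤ law P f a :=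
  Finset.sum_nonneg fun ω _ => by split_ifs; exacts [hP ω, le_rfl]

lemma le_law (P : Ω → ℝ) (hP : ∀ ω, 0 ≤ P ω) (f : Ω → α) (ω : Ω) : P ω ≤ law P f (f ω) := by
  classical
  unfold law
  have := Finset.single_le_sum (f := fun ω' => if f ω' = f ω then P ω' else 0)
    (fun ω _ => by split_ifs; exacts [hP ω, le_rfl]) (Finset.mem_univ ω)
  simpa using this

lemma law_mono (P : Ω → ℝ) (hP : ∀ ω, 0 ≤ P ω) (f : Ω → α) (g : Ω → β)
    (h : ∀ ω ω', f ω = f ω' → g ω = g ω') (ω : Ω) : law P f (f ω) ≤ law P g (g ω) := by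
  refine Finset.sum_le_sum fun ω' _ => ?_
  by_cases h1 : f ω' = f ω
  · rw [if_pos h1, if_pos (h _ _ h1)]
  · rw [if_neg h1]
    split_ifs; exacts [hP ω', le_rfl]

lemma hf_eq (P : Ω → ℝ) (f : Ω → α) : hf P f = - ∑ ω, P ω * Real.log (law P f (f ω)) := by
  rw [← law_sum P f (fun a => Real.log (law P f a)), hf, ← Finset.sum_neg_distrib]
  refine Finset.sum_congr rfl fun a _ => ?_
  rw [Real.negMulLog]; ring

lemma hf_mono (P : Ω → ℝ) (hP : ∀ ω, 0 ≤ P ω) (f : Ω → α) (g : Ω → β)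
    (h : ∀ ω ω', f ω = f ω' → g ω = g ω') : hf P g ≤ hf P f := by
  rw [hf_eq, hf_eq]
  apply neg_le_neg
  refine Finset.sum_le_sum fun ω _ => ?_
  rcases (hP ω).eq_or_lt with h0 | h0
  · simp [← h0]
  · refine mul_le_mul_of_nonneg_left ?_ h0.le
    exact Real.log_le_log (h0.trans_le (le_law P hP f ω)) (law_mono P hP f g h ω)

lemma hf_congr (P : Ω → ℝ) (hP : ∀ ω, 0 ≤ P ω) (f : Ω → α) (g : Ω → β)
    (h : ∀ ω ω', f ω = f ω' ↔ g ω = g ω') : hf P f = hf P g :=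
  le_antisymm (hf_mono P hP g f fun ω ω' => (h ω ω').2) (hf_mono P hP f g fun ω ω' => (h ω ω').1)

lemma gibbs (P : Ω → ℝ) (hP : ∀ ω, 0 ≤ P ω) (hP1 : ∑ ω, P ω = 1) (f : Ω → α) (q : α → ℝ)
    (hq : ∀ a, 0 ≤ q a) (hq1 : ∑ a, q a ≤ 1) (hqp : ∀ ω, 0 < P ω → 0 < q (f ω)) :
    hf P f ≤ - ∑ ω, P ω * Real.log (q (f ω)) := by
  rw [hf_eq]
  have h1 : ∀ ω, P ω * Real.log (q (f ω)) ≤ P ω * Real.log (law P f (f ω)) + P ω * (q (f ω) / law P f (f ω)) - P ω := by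
    intro ω
    rcases (hP ω).eq_or_lt with h0 | h0
    · simp [← h0]
    · have hl := h0.trans_le (le_law P hP f ω)
      have := Real.log_le_sub_one_of_pos (div_pos (hqp ω h0) hl)
      rw [Real.log_div (hqp ω h0).ne' hl.ne'] at this
      nlinarith [mul_le_mul_of_nonneg_left this h0.le]
  have h2 := Finset.sum_le_sum fun ω (_ : ω ∈ Finset.univ) => h1 ω
  rw [Finset.sum_sub_distrib, Finset.sum_add_distrib, hP1, ← law_sum P f (fun a => q a / law P f a)] at h2
  have h3 : ∑ a, law P f a * (q a / law P f a) ≤ ∑ a, q a := by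
    refine Finset.sum_le_sum fun a _ => ?_
    rcases (law_nonneg P hP f a).eq_or_lt with h0 | h0
    · rw [← h0]; simpa using hq a
    · rw [mul_div_cancel₀ _ h0.ne']
  linarith

lemma law_marg (P : Ω → ℝ) (f : Ω → α) (g : Ω → β) (c : β) :
    ∑ a, law P (fun ω => (f ω, g ω)) (a, c) = law P g c := by
  classical
  unfold law
  rw [Finset.sum_comm]
  refine Finset.sum_congr rfl fun ω _ => ?_
  rw [Finset.sum_eq_single (f ω)]
  · simp
  · intro a _ h
    rw [if_neg]
    intro h'
    exact h (Prod.ext_iff.1 h').1.symm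
  · simp

lemma hf_submod (P : Ω → ℝ) (hP : ∀ ω, 0 ≤ P ω) (hP1 : ∑ ω, P ω = 1) (f : Ω → α) (g : Ω → β) (h : Ω → γ) :
    hf P (fun ω => (f ω, g ω, h ω)) + hf P h ≤ hf P (fun ω => (f ω, h ω)) + hf P (fun ω => (g ω, h ω)) := by
  set lfh := law P (fun ω => (f ω, h ω)) with hlfh
  set lgh := law P (fun ω => (g ω, h ω)) with hlgh
  set lh := law P h with hlh
  have n1 : ∀ z, 0 ≤ lfh z := law_nonneg P hP _
  have n2 : ∀ z, 0 ≤ lgh z := law_nonneg P hP _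
  have n3 : ∀ z, 0 ≤ lh z := law_nonneg P hP _
  have hg := gibbs P hP hP1 (fun ω => (f ω, g ω, h ω)) (fun z => lfh (z.1, z.2.2) * lgh (z.2.1, z.2.2) / lh z.2.2)
    (fun z => div_nonneg (mul_nonneg (n1 _) (n2 _)) (n3 _)) ?_ ?_
  · refine (add_le_add_left hg _).trans ?_
    rw [hf_eq, hf_eq, hf_eq, ← neg_add, ← neg_add, neg_le_neg_iff, ← Finset.sum_add_distrib, ← Finset.sum_add_distrib]
    refine Finset.sum_le_sum fun ω _ => ?_
    rcases (hP ω).eq_or_lt with h0 | h0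
    · simp [← h0]
    · have a1 := h0.trans_le (le_law P hP (fun ω => (f ω, h ω)) ω)
      have a2 := h0.trans_le (le_law P hP (fun ω => (g ω, h ω)) ω)
      have a3 := h0.trans_le (le_law P hP h ω)
      rw [Real.log_div (mul_pos a1 a2).ne' a3.ne', Real.log_mul a1.ne' a2.ne']
      apply le_of_eq
      ring
  · rw [Fintype.sum_prod_type]
    simp only [Fintype.sum_prod_type]
    have : ∀ x : α, ∑ y : β, ∑ z : γ, lfh (x, z) * lgh (y, z) / lh z = ∑ z : γ, lfh (x, z) * (lh z / lh z) := by
      intro x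
      rw [Finset.sum_comm]
      refine Finset.sum_congr rfl fun z _ => ?_
      rw [← Finset.sum_div, ← Finset.mul_sum, hlgh, law_marg, mul_div_assoc]
    simp only [this]
    rw [Finset.sum_comm, ← hP1, ← law_total P h]
    refine Finset.sum_le_sum fun z _ => ?_
    rw [← Finset.sum_mul, hlfh, law_marg]
    exact mul_le_of_le_one_right (n3 z) (div_self_le_one _)
  · intro ω h0
    have a1 := h0.trans_le (le_law P hP (fun ω => (f ω, h ω)) ω)
    have a2 := h0.trans_le (le_law P hP (fun ω => (g ω, h ω)) ω)
    have a3 := h0.trans_le (le_law P hP h ω)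
    exact div_pos (mul_pos a1 a2) a3

lemma hf_nonneg (P : Ω → ℝ) (hP : ∀ ω, 0 ≤ P ω) (hP1 : ∑ ω, P ω = 1) (f : Ω → α) : 0 ≤ hf P f := by
  refine Finset.sum_nonneg fun a _ => Real.negMulLog_nonneg (law_nonneg P hP f a) ?_
  rw [← hP1, ← law_total P f]
  exact Finset.single_le_sum (fun a _ => law_nonneg P hP f a) (Finset.mem_univ a)

lemma hf_const (P : Ω → ℝ) (hP1 : ∑ ω, P ω = 1) : hf P (fun _ => ()) = 0 := by
  simp [hf, law, hP1]

lemma hf_subadd (P : Ω → ℝ) (hP : ∀ ω, 0 ≤ P ω) (hP1 : ∑ ω, P ω = 1) (f : Ω → α) (g : Ω → β) :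
    hf P (fun ω => (f ω, g ω)) ≤ hf P f + hf P g := by
  have h := hf_submod P hP hP1 f g (fun _ => ())
  rw [hf_const P hP1] at h
  rw [hf_congr P hP (fun ω => (f ω, g ω)) (fun ω => (f ω, g ω, ())) (by simp),
    hf_congr P hP f (fun ω => (f ω, ())) (by simp), hf_congr P hP g (fun ω => (g ω, ())) (by simp)]
  linarith

lemma hf_fst {U : Type*} [Fintype U] (P : Ω → ℝ) (J : Ω × U → ℝ) (hJ : ∀ c, ∑ u, J (c, u) = P c) (f : Ω → α) :
    hf J (fun z => f z.1) = hf P f := by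
  unfold hf
  refine Finset.sum_congr rfl fun a _ => ?_
  congr 1
  unfold law
  rw [Fintype.sum_prod_type]
  refine Finset.sum_congr rfl fun c _ => ?_
  by_cases h : f c = a
  · simp [h, hJ]
  · simp [h]

end FiniteEntropy

lemma log_ratio_ge {h : ℝ} (h0 : 0 ≤ h) (h1 : h < 1) : 2 * h ≤ Real.log (1 + h) - Real.log (1 - h) := by
  have hs := Real.hasSum_log_sub_log_of_abs_lt_one (x := h) (by rw [abs_of_nonneg h0]; exact h1)
  have := le_hasSum hs 0 (fun k _ => by positivity)
  simpa using this

lemma exp_sub_ge {A B : ℝ} (hAB : 0 ≤ A + B) (hBA : B ≤ A) : A - B ≤ Real.exp A - Real.exp B := by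
  have h1 : Real.exp A - Real.exp B = 2 * Real.exp ((A+B)/2) * Real.sinh ((A-B)/2) := by
    rw [Real.sinh_eq]
    have e1 : Real.exp A = Real.exp ((A+B)/2) * Real.exp ((A-B)/2) := by rw [← Real.exp_add]; congr 1; ring
    have e2 : Real.exp B = Real.exp ((A+B)/2) * Real.exp (-((A-B)/2)) := by rw [← Real.exp_add]; congr 1; ring
    rw [e1, e2]; ring
  rw [h1]
  have h2 : (A-B)/2 ≤ Real.sinh ((A-B)/2) := Real.self_le_sinh_iff.2 (by linarith)
  have h3 : 1 ≤ Real.exp ((A+B)/2) := Real.one_le_exp (by linarith)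
  nlinarith

lemma zeta_step {δ y : ℝ} (hδ : 0 < δ) (hy : 1/2 < y) :
    y ^ (-1-δ) ≤ ((y - 1/2) ^ (-δ) - (y + 1/2) ^ (-δ)) / δ := by
  have hy0 : 0 < y := by linarith
  set h : ℝ := 1 / (2 * y) with hh
  have h0 : 0 < h := by positivity
  have h1 : h < 1 := by rw [hh, div_lt_one (by positivity)]; linarith
  have e1 : (y - 1/2) = y * (1 - h) := by rw [hh]; field_simp
  have e2 : (y + 1/2) = y * (1 + h) := by rw [hh]; field_simp
  have e3 : y ^ (-1-δ) = y ^ (-δ) * (2 * h) := by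
    rw [show -1 - δ = -δ + (-1) by ring, Real.rpow_add hy0, Real.rpow_neg_one, hh]; field_simp
  rw [e1, e2, Real.mul_rpow hy0.le (by linarith), Real.mul_rpow hy0.le (by linarith), e3, le_div_iff₀ hδ,
    ← mul_sub, mul_assoc]
  refine mul_le_mul_of_nonneg_left ?_ (by positivity)
  rw [Real.rpow_def_of_pos (by linarith : 0 < 1 - h), Real.rpow_def_of_pos (by linarith : 0 < 1 + h)]
  have hl := log_ratio_ge h0.le h1
  have hneg : Real.log (1 - h) + Real.log (1 + h) ≤ 0 := by
    rw [← Real.log_mul (by linarith) (by linarith)]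
    apply Real.log_nonpos <;> nlinarith
  refine le_trans ?_ (exp_sub_ge ?_ ?_) <;> nlinarith

/-- Normalization bound. -/
noncomputable def Sd (δ : ℝ) : ℝ := 4 ^ (1+δ) + (4/3) ^ δ / δ

lemma sum_range_le {δ : ℝ} (hδ : 0 < δ) (N : ℕ) :
    ∑ j ∈ Finset.range (N+1), ((j:ℝ) + 1/4) ^ (-1-δ) ≤
      4 ^ (1+δ) + ((3/4) ^ (-δ) - ((N:ℝ) + 3/4) ^ (-δ)) / δ := by
  induction N with
  | zero =>
    simp only [zero_add, Finset.sum_range_one, Nat.cast_zero, sub_self, zero_div, add_zero]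
    rw [show (-1-δ) = -(1+δ) by ring, Real.rpow_neg (by norm_num), ← Real.inv_rpow (by norm_num)]
    norm_num
  | succ k ih =>
    rw [Finset.sum_range_succ]
    have hk : (0:ℝ) ≤ k := by positivity
    have := zeta_step (y := (k:ℝ) + 1 + 1/4) hδ (by linarith)
    rw [show (k:ℝ) + 1 + 1/4 - 1/2 = k + 3/4 by ring, show (k:ℝ) + 1 + 1/4 + 1/2 = k + 1 + 3/4 by ring] at this
    push_cast
    refine (add_le_add ih this).trans (le_of_eq ?_)
    ring

lemma sum_rank_le {α : Type*} [Fintype α] (r : α → ℕ) (hr : Function.Injective r) {δ : ℝ} (hδ : 0 < δ) :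
    ∑ t, ((r t:ℝ) + 1/4) ^ (-1-δ) ≤ Sd δ := by
  classical
  have h1 : ∑ t, ((r t:ℝ) + 1/4) ^ (-1-δ) = ∑ j ∈ Finset.univ.image r, ((j:ℝ) + 1/4) ^ (-1-δ) := by
    rw [Finset.sum_image (fun a _ b _ h => hr h)]
  obtain ⟨N, hN⟩ := (Finset.univ.image r).exists_nat_subset_range
  rw [h1]
  refine (Finset.sum_le_sum_of_subset_of_nonneg (hN.trans (Finset.range_mono (Nat.le_succ N)))
    fun j _ _ => by positivity).trans ((sum_range_le hδ N).trans ?_)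
  unfold Sd
  have : ((3:ℝ)/4) ^ (-δ) = (4/3) ^ δ := by
    rw [Real.rpow_neg (by norm_num), ← Real.inv_rpow (by norm_num)]; norm_num
  rw [this]
  gcongr
  have : 0 ≤ ((N:ℝ) + 3/4) ^ (-δ) := by positivity
  linarith

lemma exp_neg_le {u : ℝ} (hu : 0 ≤ u) : Real.exp (-u) ≤ 1 - u + u^2/2 := by
  have h := Real.quadratic_le_exp_of_nonneg hu
  rw [Real.exp_neg, inv_le_iff_one_le_mul₀ (Real.exp_pos _)]
  have h2 : 0 < 1 - u + u^2/2 := by nlinarith [sq_nonneg (u-1)]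
  nlinarith [mul_le_mul_of_nonneg_left h h2.le, sq_nonneg (u^2)]

lemma numeric_delta (I : ℝ) (hI : 0 ≤ I) :
    ∃ δ : ℝ, 0 < δ ∧ δ * I + Real.log (Sd δ) ≤ Real.log (I / Real.log 2 + 5.51) + 1.06 * Real.log 2 := by
  have l2 := Real.log_two_lt_d9
  have l2' := Real.log_two_gt_d9
  have hl0 : 0 < Real.log 2 := by linarith
  set Ib := I / Real.log 2 with hIb
  have hIb0 : 0 ≤ Ib := by positivity
  have hII : I = Ib * Real.log 2 := by rw [hIb]; field_simp
  set x := 1 / (Ib + 3) with hx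
  have hx0 : 0 < x := by positivity
  have hx1 : x ≤ 1/3 := by rw [hx]; exact one_div_le_one_div_of_le (by norm_num) (by linarith)
  have hIx : Ib = 1 / x - 3 := by rw [hx]; field_simp; ring
  set δ := x / Real.log 2 with hδ
  have hδ0 : 0 < δ := by positivity
  refine ⟨δ, hδ0, ?_⟩
  have hS0 : 0 < Sd δ := by unfold Sd; positivity
  have e1 : δ * I = 1 - 3 * x := by rw [hδ, hII, hIx]; field_simp
  have e4 : (4:ℝ) ^ (1 + δ) = 4 * Real.exp (2 * x) := by
    rw [Real.rpow_add (by norm_num), Real.rpow_one, Real.rpow_def_of_pos (by norm_num)]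
    congr 2
    rw [show (4:ℝ) = 2 ^ 2 by norm_num, Real.log_pow, hδ]; field_simp; norm_num
  have e43 : ((4:ℝ)/3) ^ δ ≤ Real.exp (x / 2) := by
    rw [Real.rpow_def_of_pos (by norm_num)]
    apply Real.exp_le_exp.2
    have : Real.log (4/3) ≤ Real.log 2 / 2 := by
      have h := Real.log_le_log (by norm_num) (show ((4:ℝ)/3)^2 ≤ 2 by norm_num)
      rw [Real.log_pow] at h
      push_cast at h
      linarith
    rw [hδ]
    calc _ ≤ Real.log 2 / 2 * (x / Real.log 2) := by gcongr
      _ = _ := by field_simp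
  have hSle : Sd δ ≤ 4 * Real.exp (2 * x) + Real.exp (x/2) * 0.6932 / x := by
    unfold Sd
    rw [e4]
    have : ((4:ℝ)/3) ^ δ / δ ≤ Real.exp (x / 2) * 0.6932 / x := by
      rw [hδ, ← div_mul, div_mul_eq_mul_div]
      gcongr
      linarith
    linarith
  have hkey : Real.exp (1 - 3 * x) * Sd δ ≤ 2.083 * (Ib + 5.51) := by
    have hA : Real.exp (1 - 3*x) * Sd δ ≤ Real.exp 1 * (4 * x * Real.exp (-x) + 0.6932 * Real.exp (-(2.5 * x))) / x := by
      refine (mul_le_mul_of_nonneg_left hSle (Real.exp_pos _).le).trans (le_of_eq ?_)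
      have a1 : Real.exp (-x) = Real.exp (-(3*x)) * Real.exp (2*x) := by rw [← Real.exp_add]; congr 1; ring
      have a2 : Real.exp (-(2.5*x)) = Real.exp (-(3*x)) * Real.exp (x/2) := by rw [← Real.exp_add]; congr 1; ring
      have a3 : Real.exp (1-3*x) = Real.exp 1 * Real.exp (-(3*x)) := by rw [← Real.exp_add]; congr 1
      rw [a1, a2, a3]; field_simp
    refine hA.trans ?_
    rw [hIx, div_le_iff₀ hx0]
    have b1 := exp_neg_le hx0.le
    have b2 := exp_neg_le (u := 2.5 * x) (by positivity)
    have b3 := Real.exp_one_lt_d9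
    have c1 : 4 * x * Real.exp (-x) + 0.6932 * Real.exp (-(2.5 * x)) ≤ 
       4 * x * (1 - x + x^2/2) + 0.6932 * (1 - 2.5*x + (2.5*x)^2/2) := by gcongr
    have c0 : 0 ≤ 4 * x * Real.exp (-x) + 0.6932 * Real.exp (-(2.5 * x)) := by positivity
    have c2 : Real.exp 1 * (4 * x * Real.exp (-x) + 0.6932 * Real.exp (-(2.5 * x))) ≤
        2.7183 * (4 * x * (1 - x + x^2/2) + 0.6932 * (1 - 2.5*x + (2.5*x)^2/2)) :=
      mul_le_mul (by linarith) c1 c0 (by norm_num)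
    refine c2.trans ?_
    have : 2.083 * (1 / x - 3 + 5.51) * x = 2.083 * (1 + 2.51 * x) := by field_simp; ring
    rw [this]
    nlinarith [sq_nonneg (x - 1/3), mul_nonneg hx0.le (sub_nonneg.2 hx1), mul_nonneg (mul_nonneg hx0.le hx0.le) (sub_nonneg.2 hx1)]
  have hpow : (2.083:ℝ) ≤ Real.exp (1.06 * Real.log 2) := by
    have : Real.exp (1.06 * Real.log 2) = 2 * Real.exp (0.06 * Real.log 2) := by
      rw [show (1.06:ℝ) * Real.log 2 = Real.log 2 + 0.06 * Real.log 2 by ring, Real.exp_add, Real.exp_log (by norm_num)]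
    rw [this]
    have := Real.add_one_le_exp (0.06 * Real.log 2)
    linarith
  rw [e1]
  have hpos : 0 < Ib + 5.51 := by positivity
  have h1 : 1 - 3 * x + Real.log (Sd δ) = Real.log (Real.exp (1 - 3*x) * Sd δ) := by
    rw [Real.log_mul (Real.exp_pos _).ne' hS0.ne', Real.log_exp]
  have h2 : Real.log (Ib + 5.51) + 1.06 * Real.log 2 = Real.log (Real.exp (1.06 * Real.log 2) * (Ib + 5.51)) := by
    rw [Real.log_mul (Real.exp_pos _).ne' hpos.ne', Real.log_exp]; ring
  rw [h1, h2]
  apply Real.log_le_log (by positivity)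
  refine hkey.trans ?_
  gcongr

open MeasureTheory ProbabilityTheory

/-- Standard exponential measure. -/
noncomputable def expo : Measure ℝ :=
  (volume.restrict (Set.Ioi (0:ℝ))).withDensity (fun x => ENNReal.ofReal (Real.exp (-x)))

lemma lint_exp (k : ℝ) (hk : 0 < k) (c : ℝ) :
    ∫⁻ x in Set.Ioi c, ENNReal.ofReal (Real.exp (-k * x)) = ENNReal.ofReal (Real.exp (-k * c) / k) := by
  rw [← ofReal_integral_eq_lintegral_ofReal (exp_neg_integrableOn_Ioi c hk)
    (Filter.Eventually.of_forall fun x => (Real.exp_pos _).le)]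
  rw [integral_exp_mul_Ioi (by linarith)]
  congr 1
  field_simp

lemma lint_xexp (k : ℝ) (hk : 0 < k) :
    ∫⁻ x in Set.Ioi (0:ℝ), ENNReal.ofReal (x * Real.exp (-k * x)) = ENNReal.ofReal (1 / k ^ 2) := by
  have h1 := Real.integral_rpow_mul_exp_neg_mul_Ioi (a := 2) (r := k) (by norm_num) hk
  have h0 : ∀ x ∈ Set.Ioi (0:ℝ), x ^ ((2:ℝ) - 1) * Real.exp (-(k * x)) = x * Real.exp (-k * x) := by
    intro x hx
    norm_num
  rw [setIntegral_congr_fun measurableSet_Ioi h0] at h1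
  have h2 : Real.Gamma 2 = 1 := by
    have := Real.Gamma_nat_eq_factorial 1
    rw [show ((1:ℕ):ℝ) + 1 = 2 by norm_num] at this
    rw [this]; simp
  rw [h2, mul_one] at h1
  have h3 : (1 / k) ^ (2:ℝ) = 1 / k ^ 2 := by
    norm_num
  rw [h3] at h1
  rw [← h1]
  rw [ofReal_integral_eq_lintegral_ofReal]
  · by_contra hni
    rw [integral_undef hni] at h1
    have : 0 < 1 / k ^ 2 := by positivity
    linarith
  · filter_upwards [ae_restrict_mem measurableSet_Ioi] with x hx
    exact mul_nonneg (le_of_lt hx) (Real.exp_pos _).le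

instance expo_prob : IsProbabilityMeasure expo := by
  constructor
  rw [expo, withDensity_apply _ MeasurableSet.univ, Measure.restrict_univ]
  have := lint_exp 1 one_pos 0
  simpa using this

lemma expo_Ici (c : ℝ) : expo (Set.Ici c) ≤ ENNReal.ofReal (Real.exp (-c)) := by
  rw [expo, withDensity_apply _ measurableSet_Ici, Measure.restrict_restrict measurableSet_Ici]
  calc _ ≤ ∫⁻ x in Set.Ici c, ENNReal.ofReal (Real.exp (-x)) :=
        lintegral_mono_set Set.inter_subset_left
    _ = ∫⁻ x in Set.Ioi c, ENNReal.ofReal (Real.exp (-x)) := by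
        rw [Measure.restrict_congr_set Ioi_ae_eq_Ici]
    _ ≤ _ := by
        have := lint_exp 1 one_pos c
        simp at this
        rw [this]

lemma expo_Icc (c s : ℝ) (hc : 0 ≤ c) :
    expo (Set.Icc c s) ≤ ENNReal.ofReal (Real.exp (-c) * s) := by
  rw [expo, withDensity_apply _ measurableSet_Icc, Measure.restrict_restrict measurableSet_Icc]
  calc _ ≤ ∫⁻ x in Set.Icc c s, ENNReal.ofReal (Real.exp (-x)) :=
        lintegral_mono_set Set.inter_subset_left
    _ ≤ ∫⁻ x in Set.Icc c s, ENNReal.ofReal (Real.exp (-c)) := by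
        refine setLIntegral_mono measurable_const fun x hx => ?_
        apply ENNReal.ofReal_le_ofReal
        apply Real.exp_le_exp.2
        linarith [hx.1]
    _ = ENNReal.ofReal (Real.exp (-c)) * ENNReal.ofReal (s - c) := by
        rw [setLIntegral_const, Real.volume_Icc]
    _ ≤ _ := by
        rw [ENNReal.ofReal_mul (Real.exp_pos _).le]
        gcongr
        linarith

lemma expo_pos : ∀ᵐ x ∂expo, 0 < x := by
  have : expo ≪ volume.restrict (Set.Ioi (0:ℝ)) := withDensity_absolutelyContinuous _ _
  exact this.ae_le (ae_restrict_mem measurableSet_Ioi)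

lemma lint_expo (G : ℝ → ENNReal) (hG : Measurable G) :
    ∫⁻ x, G x ∂expo = ∫⁻ x in Set.Ioi (0:ℝ), ENNReal.ofReal (Real.exp (-x)) * G x := by
  rw [expo, lintegral_withDensity_eq_lintegral_mul _ (by fun_prop) hG]
  rfl

/-- Product of exponentials. -/
noncomputable def nu (n : ℕ) : Measure (Fin (n+1) → ℝ) := Measure.pi (fun _ => expo)

instance nu_prob (n : ℕ) : IsProbabilityMeasure (nu n) := by
  unfold nu; infer_instance

lemma race_fubini {n : ℕ} (t : Fin (n+1)) (A : ℝ → Fin n → Set ℝ)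
    (hA : MeasurableSet {E : Fin (n+1) → ℝ | ∀ i, E (t.succAbove i) ∈ A (E t) i})
    (G : ℝ → ENNReal) (hG : Measurable G) :
    ∫⁻ E in {E : Fin (n+1) → ℝ | ∀ i, E (t.succAbove i) ∈ A (E t) i}, G (E t) ∂(nu n)
      = ∫⁻ x, G x * ∏ i, expo (A x i) ∂expo := by
  rw [← lintegral_indicator hA]
  have hmp := (measurePreserving_piFinSuccAbove (fun _ : Fin (n+1) => expo) t).symm
  have hmeas : Measurable (Set.indicator {E : Fin (n+1) → ℝ | ∀ i, E (t.succAbove i) ∈ A (E t) i}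
      fun E => G (E t)) := (hG.comp (measurable_pi_apply t)).indicator hA
  unfold nu
  have hm2 := hmeas.comp (MeasurableEquiv.piFinSuccAbove (fun _ : Fin (n+1) => ℝ) t).symm.measurable
  rw [← hmp.lintegral_comp hmeas]
  rw [lintegral_prod (fun a => Set.indicator {E : Fin (n+1) → ℝ | ∀ i, E (t.succAbove i) ∈ A (E t) i}
      (fun E => G (E t)) ((MeasurableEquiv.piFinSuccAbove (fun _ => ℝ) t).symm a)) hm2.aemeasurable]
  refine lintegral_congr fun x => ?_
  have hh1 : ∀ y : Fin n → ℝ, (MeasurableEquiv.piFinSuccAbove (fun _ => ℝ) t).symm (x, y) t = x := by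
    intro y
    simp [MeasurableEquiv.piFinSuccAbove_symm_apply]
  have hh2 : ∀ (y : Fin n → ℝ) i,
      (MeasurableEquiv.piFinSuccAbove (fun _ => ℝ) t).symm (x, y) (t.succAbove i) = y i := by
    intro y i
    simp [MeasurableEquiv.piFinSuccAbove_symm_apply]
  have : ∀ y : Fin n → ℝ, Set.indicator {E : Fin (n+1) → ℝ | ∀ i, E (t.succAbove i) ∈ A (E t) i}
      (fun E => G (E t)) ((MeasurableEquiv.piFinSuccAbove (fun _ => ℝ) t).symm (x, y))
      = Set.indicator (Set.pi Set.univ (A x)) (fun _ => G x) y := by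
    intro y
    have hiff : (MeasurableEquiv.piFinSuccAbove (fun _ => ℝ) t).symm (x, y) ∈
        {E : Fin (n+1) → ℝ | ∀ i, E (t.succAbove i) ∈ A (E t) i} ↔ y ∈ Set.pi Set.univ (A x) := by
      simp only [Set.mem_ofPred_eq, hh1, hh2, Set.mem_univ_pi]
    by_cases h : y ∈ Set.pi Set.univ (A x)
    · rw [Set.indicator_of_mem h, Set.indicator_of_mem (hiff.2 h), hh1]
    · rw [Set.indicator_of_notMem h, Set.indicator_of_notMem (fun h' => h (hiff.1 h'))]
  simp only [this]
  have hs : MeasurableSet (Set.pi Set.univ (A x)) := by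
    have h1 : Measurable (fun y : Fin n → ℝ => (MeasurableEquiv.piFinSuccAbove (fun _ => ℝ) t).symm (x, y)) :=
      (MeasurableEquiv.measurable _).comp measurable_prodMk_left
    have h2 := h1 hA
    convert h2 using 1
    ext y
    simp only [Set.mem_ofPred_eq, Set.mem_preimage, hh1, hh2, Set.mem_univ_pi]
  rw [lintegral_indicator hs, setLIntegral_const, Measure.pi_pi]

lemma meas_ge {n : ℕ} (t : Fin (n+1)) (c : Fin n → ℝ) :
    MeasurableSet {E : Fin (n+1) → ℝ | ∀ i, c i * E t ≤ E (t.succAbove i)} := by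
  have h : ∀ i, MeasurableSet {E : Fin (n+1) → ℝ | c i * E t ≤ E (t.succAbove i)} :=
    fun i => measurableSet_le (by fun_prop) (by fun_prop)
  have h2 := MeasurableSet.iInter h
  convert h2 using 1
  ext E
  simp

lemma race1 {n : ℕ} (t : Fin (n+1)) (c : Fin n → ℝ) 
    (G : ℝ → ENNReal) (hG : Measurable G) :
    ∫⁻ E in {E : Fin (n+1) → ℝ | ∀ i, c i * E t ≤ E (t.succAbove i)}, G (E t) ∂(nu n)
      ≤ ∫⁻ x in Set.Ioi (0:ℝ), ENNReal.ofReal (Real.exp (-(1 + ∑ i, c i) * x)) * G x := by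
  have hA : MeasurableSet {E : Fin (n+1) → ℝ | ∀ i, E (t.succAbove i) ∈ Set.Ici (c i * E t)} := by
    exact meas_ge t c
  have := race_fubini t (fun x i => Set.Ici (c i * x)) hA G hG
  simp only [Set.mem_Ici] at this
  rw [this]
  calc _ ≤ ∫⁻ x, G x * ∏ i, ENNReal.ofReal (Real.exp (-(c i * x))) ∂expo := by
        refine lintegral_mono fun x => ?_
        dsimp only
        gcongr with i
        exact expo_Ici _
    _ = _ := by
        rw [lint_expo _ (by fun_prop)]
        refine lintegral_congr fun x => ?_
        rw [mul_comm (G x), ← mul_assoc, ← ENNReal.ofReal_prod_of_nonneg (fun i _ => (Real.exp_pos _).le),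
          ← ENNReal.ofReal_mul (Real.exp_pos _).le, ← Real.exp_sum, ← Real.exp_add]
        congr 3
        rw [Finset.sum_neg_distrib, ← Finset.sum_mul]
        ring

lemma race2 {n : ℕ} (t : Fin (n+1)) (c : Fin n → ℝ) (hc : ∀ i, 0 ≤ c i) (i0 : Fin n) (s : ℝ)
    (G : ℝ → ENNReal) (hG : Measurable G) :
    ∫⁻ E in {E : Fin (n+1) → ℝ | (∀ i, c i * E t ≤ E (t.succAbove i)) ∧ E (t.succAbove i0) ≤ s * E t},
        G (E t) ∂(nu n)
      ≤ ∫⁻ x in Set.Ioi (0:ℝ), ENNReal.ofReal (s * x * Real.exp (-(1 + ∑ i, c i) * x)) * G x := by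
  classical
  set A : ℝ → Fin n → Set ℝ := fun x i => if i = i0 then Set.Icc (c i * x) (s * x) else Set.Ici (c i * x)
    with hAdef
  have hset : {E : Fin (n+1) → ℝ | (∀ i, c i * E t ≤ E (t.succAbove i)) ∧ E (t.succAbove i0) ≤ s * E t}
     = {E : Fin (n+1) → ℝ | ∀ i, E (t.succAbove i) ∈ A (E t) i} := by
    ext E
    simp only [Set.mem_ofPred_eq, hAdef]
    constructor
    · rintro ⟨h1, h2⟩ i
      split_ifs with h
      · subst h; exact ⟨h1 i, h2⟩
      · exact h1 i
    · intro h
      refine ⟨fun i => ?_, ?_⟩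
      · have := h i
        split_ifs at this with h'
        · exact this.1
        · exact this
      · have := h i0
        simp only [if_true] at this
        exact this.2
  have hm : MeasurableSet {E : Fin (n+1) → ℝ | (∀ i, c i * E t ≤ E (t.succAbove i)) ∧ E (t.succAbove i0) ≤ s * E t} := by
    refine MeasurableSet.inter ?_ ?_
    · change MeasurableSet {E : Fin (n+1) → ℝ | ∀ i, c i * E t ≤ E (t.succAbove i)}
      exact meas_ge t c
    · have : MeasurableSet {E : Fin (n+1) → ℝ | E (t.succAbove i0) ≤ s * E t} :=
        measurableSet_le (by fun_prop) (by fun_prop)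
      exact this
  rw [hset] at hm ⊢
  rw [race_fubini t A hm G hG]
  calc _ ≤ ∫⁻ x, G x * ∏ i, (ENNReal.ofReal (Real.exp (-(c i * x))) * (if i = i0 then ENNReal.ofReal (s * x) else 1)) ∂expo := by
        refine lintegral_mono_ae ?_
        filter_upwards [expo_pos] with x hx
        gcongr with i
        simp only [hAdef]
        split_ifs with h
        · rw [← ENNReal.ofReal_mul (Real.exp_pos _).le]
          exact expo_Icc _ _ (mul_nonneg (hc i) hx.le)
        · rw [mul_one]
          exact expo_Ici _
    _ = _ := by
        simp only [Finset.prod_mul_distrib, Finset.prod_ite_eq', Finset.mem_univ, if_true]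
        rw [lint_expo _ (by fun_prop)]
        refine lintegral_congr fun x => ?_
        rw [mul_comm (G x), ← mul_assoc, ← ENNReal.ofReal_prod_of_nonneg (fun i _ => (Real.exp_pos _).le),
          ← ENNReal.ofReal_mul (Finset.prod_nonneg fun i _ => (Real.exp_pos _).le), ← ENNReal.ofReal_mul (Real.exp_pos _).le,
          ← Real.exp_sum, ← mul_assoc, ← Real.exp_add, mul_comm (s * x)]
        congr 4
        rw [Finset.sum_neg_distrib, ← Finset.sum_mul]
        ring


lemma int_le_of_lint {Ω : Type*} [MeasurableSpace Ω] (ν : Measure Ω) (Fs B : Set Ω)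
    (hsub : Fs ⊆ B) (g : Ω → ℝ) (hg : Measurable g) (hg0 : ∀ E, E ∈ Fs → 0 ≤ g E) (hFm : MeasurableSet Fs) (K : ℝ) (hK : 0 ≤ K)
    (h : ∫⁻ E in B, ENNReal.ofReal (g E) ∂ν ≤ ENNReal.ofReal K) :
    IntegrableOn g Fs ν ∧ ∫ E in Fs, g E ∂ν ≤ K := by
  have h1 : ∫⁻ E in Fs, ENNReal.ofReal (g E) ∂ν ≤ ENNReal.ofReal K :=
    (lintegral_mono_set hsub).trans h
  have hae : 0 ≤ᵐ[ν.restrict Fs] g := by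
    filter_upwards [ae_restrict_mem hFm] with E hE using hg0 E hE
  constructor
  · refine ⟨hg.aestronglyMeasurable, ?_⟩
    rw [hasFiniteIntegral_iff_ofReal hae]
    exact h1.trans_lt ENNReal.ofReal_lt_top
  · rw [integral_eq_lintegral_of_nonneg_ae hae hg.aestronglyMeasurable]
    exact ENNReal.toReal_le_of_le_ofReal hK h1

lemma exp34 : Real.exp (3/4) ≤ 49/23 := by
  have h := Real.exp_bound' (x := 3/4) (by norm_num) (by norm_num) (n := 6) (by norm_num)
  refine h.trans ?_
  norm_num [Finset.sum_range_succ, Nat.factorial]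

lemma race_core {n : ℕ} (t : Fin (n+1)) (w p : Fin (n+1) → ℝ) (hw : ∀ i, 0 ≤ w i) (hw1 : ∑ i, w i = 1)
    (hp : ∀ i, 0 ≤ p i) (hp1 : ∑ i, p i = 1) (hwt : 0 < w t) (hpt : 0 < p t)
    (Fs : Set (Fin (n+1) → ℝ)) (hFm : MeasurableSet Fs)
    (hF : ∀ E ∈ Fs, 0 < E t ∧ ∀ i, w (t.succAbove i) / w t * E t ≤ E (t.succAbove i))
    (hFw : (nu n).real Fs = w t)
    (j : (Fin (n+1) → ℝ) → ℕ) (hj : Measurable j)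
    (hjF : ∀ E ∈ Fs, (j E : ℝ) ≤ ∑ i, if E (t.succAbove i) ≤ p (t.succAbove i) / p t * E t then (1:ℝ) else 0) :
    ∫ E in Fs, Real.log (j E + 1/4) ∂(nu n) ≤
      w t * (Real.log (w t / p t) + 7/23 * (p t / w t - 1)) := by
  set c : Fin n → ℝ := fun i => w (t.succAbove i) / w t with hc
  set s : Fin n → ℝ := fun i => p (t.succAbove i) / p t with hs
  have hc0 : ∀ i, 0 ≤ c i := fun i => div_nonneg (hw _) hwt.le
  have hs0 : ∀ i, 0 ≤ s i := fun i => div_nonneg (hp _) hpt.le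
  have hcs : 1 + ∑ i, c i = 1 / w t := by
    rw [hc, ← Finset.sum_div]
    rw [Fin.sum_univ_succAbove _ t] at hw1
    field_simp
    linarith
  have hss : ∑ i, s i ≤ 1 / p t := by
    rw [hs, ← Finset.sum_div]
    rw [Fin.sum_univ_succAbove _ t] at hp1
    gcongr
    linarith
  set B : Set (Fin (n+1) → ℝ) := {E | ∀ i, c i * E t ≤ E (t.succAbove i)} with hB
  have hFB : Fs ⊆ B := fun E hE => (hF E hE).2
  set β : ℝ := 3/4 with hβ
  -- I2
  have hI2 : IntegrableOn (fun E : Fin (n+1) → ℝ => E t) Fs (nu n) ∧ ∫ E in Fs, E t ∂(nu n) ≤ (w t)^2 := by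
    refine int_le_of_lint _ Fs B hFB _ (by fun_prop) (fun E hE => (hF E hE).1.le) hFm _ (by positivity) ?_
    refine (race1 t c (fun x => ENNReal.ofReal x) (by fun_prop)).trans ?_
    have h := lint_xexp (1 / w t) (by positivity)
    rw [hcs]
    refine le_of_eq ?_
    calc _ = ∫⁻ x in Set.Ioi (0:ℝ), ENNReal.ofReal (x * Real.exp (-(1 / w t) * x)) := by
          refine lintegral_congr fun x => ?_
          rw [← ENNReal.ofReal_mul (Real.exp_pos _).le, mul_comm]
      _ = _ := by
          rw [h]; congr 1; field_simp
  have hI3 : IntegrableOn (fun E : Fin (n+1) → ℝ => Real.exp (-(β / w t) * E t)) Fs (nu n) ∧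
      ∫ E in Fs, Real.exp (-(β / w t) * E t) ∂(nu n) ≤ w t / (1 + β) := by
    refine int_le_of_lint _ Fs B hFB _ (by fun_prop) (fun E hE => (Real.exp_pos _).le) hFm _ (by positivity) ?_
    refine (race1 t c (fun x => ENNReal.ofReal (Real.exp (-(β / w t) * x))) (by fun_prop)).trans ?_
    have h := lint_exp ((1 + β) / w t) (by positivity) 0
    rw [hcs]
    refine le_of_eq ?_
    calc _ = ∫⁻ x in Set.Ioi (0:ℝ), ENNReal.ofReal (Real.exp (-((1 + β) / w t) * x)) := by
          refine lintegral_congr fun x => ?_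
          rw [← ENNReal.ofReal_mul (Real.exp_pos _).le, ← Real.exp_add]
          congr 2; ring
      _ = _ := by
          rw [h]; congr 1; simp
  have hI4 : ∀ i, IntegrableOn (fun E : Fin (n+1) → ℝ => 
        Real.exp (-(β / w t) * E t) * (if E (t.succAbove i) ≤ s i * E t then (1:ℝ) else 0)) Fs (nu n) ∧
      ∫ E in Fs, Real.exp (-(β / w t) * E t) * (if E (t.succAbove i) ≤ s i * E t then (1:ℝ) else 0) ∂(nu n)
        ≤ s i * ((w t)^2 / (1 + β)^2) := by
    intro i
    have hms : MeasurableSet {E : Fin (n+1) → ℝ | E (t.succAbove i) ≤ s i * E t} :=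
      measurableSet_le (by fun_prop) (by fun_prop)
    have hBm : MeasurableSet B := meas_ge t c
    have hK : 0 ≤ s i * ((w t)^2 / (1 + β)^2) := mul_nonneg (hs0 i) (by positivity)
    refine int_le_of_lint _ Fs B hFB _ ?_ ?_ hFm _ hK ?_
    · exact (by fun_prop : Measurable fun E : Fin (n+1) → ℝ => Real.exp (-(β / w t) * E t)).mul
        (Measurable.ite hms measurable_const measurable_const)
    · intro E _
      exact mul_nonneg (Real.exp_pos _).le (by split_ifs <;> norm_num)
    have h2 := race2 t c hc0 i (s i) (fun x => ENNReal.ofReal (Real.exp (-(β / w t) * x))) (by fun_prop)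
    have h := lint_xexp ((1 + β) / w t) (by positivity)
    calc _ = ∫⁻ E in B, Set.indicator {E : Fin (n+1) → ℝ | E (t.succAbove i) ≤ s i * E t}
            (fun E => ENNReal.ofReal (Real.exp (-(β / w t) * E t))) E ∂(nu n) := by
          refine lintegral_congr fun E => ?_
          by_cases hE : E (t.succAbove i) ≤ s i * E t
          · rw [Set.indicator_of_mem (by exact hE)]; simp [hE]
          · rw [Set.indicator_of_notMem (by exact hE)]; simp [hE]
      _ = ∫⁻ E in {E : Fin (n+1) → ℝ | (∀ i, c i * E t ≤ E (t.succAbove i)) ∧ E (t.succAbove i) ≤ s i * E t},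
            ENNReal.ofReal (Real.exp (-(β / w t) * E t)) ∂(nu n) := by
          rw [lintegral_indicator hms, Measure.restrict_restrict hms, Set.inter_comm]
          rfl
      _ ≤ _ := h2
      _ = ENNReal.ofReal (s i) * ∫⁻ x in Set.Ioi (0:ℝ), ENNReal.ofReal (x * Real.exp (-((1 + β) / w t) * x)) := by
          rw [← lintegral_const_mul _ (by fun_prop)]
          refine setLIntegral_congr_fun measurableSet_Ioi fun x hx => ?_
          have hx0 : (0:ℝ) < x := hx
          rw [← ENNReal.ofReal_mul (mul_nonneg (mul_nonneg (hs0 i) hx0.le) (Real.exp_pos _).le), ← ENNReal.ofReal_mul (hs0 i),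
            mul_assoc (s i * x), ← Real.exp_add, hcs, mul_assoc (s i)]
          congr 4; ring
      _ = _ := by
          rw [h, ← ENNReal.ofReal_mul (hs0 i)]
          congr 1; field_simp
  -- pointwise bound
  set ρ : ℝ := w t / p t with hρ
  have hρ0 : 0 < ρ := by positivity
  have hpt' : ∀ E ∈ Fs, Real.log (j E + 1/4) ≤ (Real.log ρ - β - 1) + β / w t * E t
      + Real.exp β / ρ / 4 * Real.exp (-(β / w t) * E t)
      + ∑ i, Real.exp β / ρ * (Real.exp (-(β / w t) * E t) * (if E (t.succAbove i) ≤ s i * E t then (1:ℝ) else 0)) := by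
    intro E hE
    have hj1 := hjF E hE
    have hy : (0:ℝ) < j E + 1/4 := by positivity
    set z := β / w t * E t - β with hz
    have hlog : Real.log (j E + 1/4) ≤ Real.log ρ + z + (j E + 1/4) * (Real.exp (-z) / ρ) - 1 := by
      have h1 := Real.log_le_sub_one_of_pos (x := (j E + 1/4) * (Real.exp (-z) / ρ)) (by positivity)
      rw [Real.log_mul hy.ne' (by positivity), Real.log_div (by positivity) hρ0.ne', Real.log_exp] at h1
      linarith
    have hez : Real.exp (-z) = Real.exp β * Real.exp (-(β / w t) * E t) := by
      rw [← Real.exp_add]; congr 1; rw [hz]; ring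
    have h2 : (j E + 1/4 : ℝ) * (Real.exp (-z) / ρ) ≤
        ((∑ i, if E (t.succAbove i) ≤ s i * E t then (1:ℝ) else 0) + 1/4) * (Real.exp (-z) / ρ) := by
      gcongr
    rw [← Finset.mul_sum, ← Finset.mul_sum]
    rw [hez] at h2 hlog
    refine hlog.trans ?_
    refine (sub_le_sub_right (add_le_add_right h2 _) _).trans (le_of_eq ?_)
    rw [hz]; ring
  have hjm : Measurable (fun E => Real.log (j E + 1/4)) := by
    have : Measurable (fun E => (j E : ℝ)) := measurable_from_top.comp hj
    exact Real.measurable_log.comp (this.add_const _)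
  have hint1 : IntegrableOn (fun E : Fin (n+1) → ℝ => (Real.log ρ - β - 1) + β / w t * E t
      + Real.exp β / ρ / 4 * Real.exp (-(β / w t) * E t)) Fs (nu n) :=
    ((integrable_const _).add (hI2.1.const_mul _)).add (hI3.1.const_mul _)
  have hint2 : IntegrableOn (fun E : Fin (n+1) → ℝ => 
      ∑ i, Real.exp β / ρ * (Real.exp (-(β / w t) * E t) * (if E (t.succAbove i) ≤ s i * E t then (1:ℝ) else 0))) Fs (nu n) :=
    integrable_finsetSum _ fun i _ => (hI4 i).1.const_mul _
  have hlint : IntegrableOn (fun E => Real.log (j E + 1/4)) Fs (nu n) := by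
    refine Integrable.mono' (g := fun E => |(Real.log ρ - β - 1) + β / w t * E t
      + Real.exp β / ρ / 4 * Real.exp (-(β / w t) * E t)
      + ∑ i, Real.exp β / ρ * (Real.exp (-(β / w t) * E t) * (if E (t.succAbove i) ≤ s i * E t then (1:ℝ) else 0))|
        + |Real.log (1/4)|)
      ((hint1.add hint2).abs.add (integrable_const _)) hjm.aestronglyMeasurable ?_
    filter_upwards [ae_restrict_mem hFm] with E hE
    have h1 := hpt' E hE
    have h2 : Real.log (1/4) ≤ Real.log (j E + 1/4) := by
      apply Real.log_le_log (by norm_num)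
      have : (0:ℝ) ≤ j E := by positivity
      linarith
    rw [Real.norm_eq_abs, abs_le]
    have h3 := neg_abs_le (Real.log (1/4))
    have h4 := le_abs_self ((Real.log ρ - β - 1) + β / w t * E t
      + Real.exp β / ρ / 4 * Real.exp (-(β / w t) * E t)
      + ∑ i, Real.exp β / ρ * (Real.exp (-(β / w t) * E t) * (if E (t.succAbove i) ≤ s i * E t then (1:ℝ) else 0)))
    have h5 := abs_nonneg (Real.log (1/4))
    have h6 := abs_nonneg ((Real.log ρ - β - 1) + β / w t * E t
      + Real.exp β / ρ / 4 * Real.exp (-(β / w t) * E t)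
      + ∑ i, Real.exp β / ρ * (Real.exp (-(β / w t) * E t) * (if E (t.succAbove i) ≤ s i * E t then (1:ℝ) else 0)))
    constructor <;> linarith
  have hmain := setIntegral_mono_on hlint (hint1.add hint2) hFm hpt'
  refine hmain.trans ?_
  simp only [Pi.add_apply]
  have hint0 : IntegrableOn (fun E : Fin (n+1) → ℝ => (Real.log ρ - β - 1) + β / w t * E t) Fs (nu n) :=
    (integrable_const _).add (hI2.1.const_mul _)
  rw [integral_add hint1 hint2, integral_add hint0 (hI3.1.const_mul _),
    integral_add (integrable_const _) (hI2.1.const_mul _), integral_const_mul, integral_const_mul,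
    integral_finsetSum _ fun i _ => (hI4 i).1.const_mul _]
  simp only [integral_const_mul, setIntegral_const, smul_eq_mul, hFw]
  have e0 := Real.exp_pos β
  have hS : ∑ i, Real.exp β / ρ * ∫ E in Fs, Real.exp (-(β / w t) * E t) * (if E (t.succAbove i) ≤ s i * E t then (1:ℝ) else 0) ∂(nu n)
      ≤ Real.exp β / ρ * (1 / p t * ((w t)^2 / (1 + β)^2)) := by
    rw [← Finset.mul_sum]
    gcongr
    refine (Finset.sum_le_sum fun i _ => (hI4 i).2).trans ?_
    rw [← Finset.sum_mul]
    gcongr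
  have hT2 : β / w t * ∫ E in Fs, E t ∂(nu n) ≤ β / w t * (w t)^2 := by
    gcongr; exact hI2.2
  have hT3 : Real.exp β / ρ / 4 * ∫ E in Fs, Real.exp (-(β / w t) * E t) ∂(nu n)
      ≤ Real.exp β / ρ / 4 * (w t / (1 + β)) := by
    gcongr; exact hI3.2
  refine (add_le_add (add_le_add (add_le_add_right hT2 _) hT3) hS).trans ?_
  have hexp : Real.exp β ≤ 49/23 := exp34
  have k1 : Real.exp β / ρ * (1 / p t * ((w t)^2 / (1 + β)^2)) ≤ 16/23 * w t := by
    have : Real.exp β / ρ * (1 / p t * ((w t)^2 / (1 + β)^2)) = Real.exp β * (16/49) * w t := by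
      rw [hρ, hβ]; field_simp; norm_num
    rw [this]
    gcongr
    linarith
  have k2 : Real.exp β / ρ / 4 * (w t / (1 + β)) ≤ 7/23 * p t := by
    have : Real.exp β / ρ / 4 * (w t / (1 + β)) = Real.exp β * (1/7) * p t := by
      rw [hρ, hβ]; field_simp; norm_num
    rw [this]
    gcongr
    linarith
  have k3 : β / w t * (w t)^2 = β * w t := by field_simp
  have k4 : w t * (Real.log ρ + 7/23 * (p t / w t - 1)) = w t * Real.log ρ + 7/23 * p t - 7/23 * w t := by
    field_simp
    ring
  rw [k4, k3]
  nlinarith [k1, k2]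

lemma disc_int {Ω U : Type*} [MeasurableSpace Ω] (ν : Measure Ω) [IsProbabilityMeasure ν] [Fintype U]
    [MeasurableSpace U] [MeasurableSingletonClass U] (D : Ω → U) (hD : Measurable D) (g : U → ℝ) :
    ∫ E, g (D E) ∂ν = ∑ u, ν.real (D ⁻¹' {u}) * g u := by
  have hg : Measurable g := measurable_of_finite g
  rw [← integral_map (φ := D) (f := g) hD.aemeasurable hg.aestronglyMeasurable]
  have : IsProbabilityMeasure (ν.map D) := Measure.isProbabilityMeasure_map hD.aemeasurable
  rw [integral_fintype (Integrable.of_finite)]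
  refine Finset.sum_congr rfl fun u _ => ?_
  rw [map_measureReal_apply hD (measurableSet_singleton u), smul_eq_mul]

lemma exists_rank {n : ℕ} (f : Fin (n+1) → ℝ) :
    ∃ r : Fin (n+1) → ℕ, Function.Injective r ∧
      ∀ t, r t + 1 ≤ (Finset.univ.filter fun t' => f t ≤ f t').card := by
  classical
  set σ := Tuple.sort (fun t => - f t) with hσ
  have hm : Monotone ((fun t => - f t) ∘ σ) := Tuple.monotone_sort _
  refine ⟨fun t => (σ.symm t).val, ?_, ?_⟩
  · intro a b h
    exact σ.symm.injective (Fin.ext h)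
  · intro t
    have h1 : (Finset.Iic (σ.symm t)).card = (σ.symm t).val + 1 := by simp
    rw [← h1]
    refine Finset.card_le_card_of_injOn σ ?_ σ.injective.injOn
    intro i hi
    have hi' : i ≤ σ.symm t := by simpa using hi
    have := hm hi'
    simp at this
    simpa using this

open Classical in
lemma race_fin {n : ℕ} {B : Type} [Fintype B] (w : B → Fin (n+1) → ℝ) (p : Fin (n+1) → ℝ)
    (hw : ∀ b i, 0 ≤ w b i) (hw1 : ∀ b, ∑ i, w b i = 1)
    (hp : ∀ i, 0 ≤ p i) (hp1 : ∑ i, p i = 1) :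
    ∃ (U : Type) (_ : Fintype U) (m : U → ℝ) (F : U → B → Fin (n+1)) (r : U → Fin (n+1) → ℕ),
      (∀ u, 0 ≤ m u) ∧ ∑ u, m u = 1 ∧ (∀ u, Function.Injective (r u)) ∧
      (∀ b t, ∑ u, (m u * if F u b = t then 1 else 0) = w b t) ∧
      ∀ b t, 0 < p t → 0 < w b t →
        ∑ u, (m u * if F u b = t then Real.log (r u t + 1/4) else 0) ≤
          w b t * (Real.log (w b t / p t) + 7/23 * (p t / w b t - 1)) := by
  set v : Option B → Fin (n+1) → ℝ := fun o => o.elim p w with hv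
  set D : (Fin (n+1) → ℝ) → (Option B → Fin (n+1) → Fin (n+1) → Bool) :=
    fun E o t t' => decide (v o t' * E t ≤ v o t * E t') with hD
  have hDm : Measurable D := by
    refine measurable_pi_iff.2 fun o => measurable_pi_iff.2 fun t => measurable_pi_iff.2 fun t' => ?_
    refine measurable_to_bool ?_
    have : MeasurableSet {E : Fin (n+1) → ℝ | v o t' * E t ≤ v o t * E t'} :=
      measurableSet_le (by fun_prop) (by fun_prop)
    convert this using 1
    ext E
    simp [hD]
  have hDw : ∀ E b t t', D E (some b) t t' = true ↔ w b t' * E t ≤ w b t * E t' :=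
    fun _ _ _ _ => decide_eq_true_iff
  have hDp : ∀ E t t', D E none t t' = true ↔ p t' * E t ≤ p t * E t' :=
    fun _ _ _ => decide_eq_true_iff
  set F : (Option B → Fin (n+1) → Fin (n+1) → Bool) → B → Fin (n+1) := fun u b =>
    if h : ∃ t, ∀ t', u (some b) t t' = true then h.choose else 0 with hF
  set r : (Option B → Fin (n+1) → Fin (n+1) → Bool) → Fin (n+1) → ℕ := fun u =>
    if h : ∃ r : Fin (n+1) → ℕ, Function.Injective r ∧
      ∀ t, r t + 1 ≤ (Finset.univ.filter fun t' => u none t' t = true).card then h.choose else Fin.val with hr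
  have hpos : ∀ᵐ E ∂(nu n), ∀ i, 0 < E i := by
    rw [ae_all_iff]
    intro i
    have := (measurePreserving_eval (fun _ : Fin (n+1) => expo) i).quasiMeasurePreserving.ae expo_pos
    exact this
  have hPm : MeasurableSet {E : Fin (n+1) → ℝ | ∀ i, 0 < E i} := by
    have h : ∀ i, MeasurableSet {E : Fin (n+1) → ℝ | 0 < E i} :=
      fun i => measurableSet_lt (by fun_prop) (by fun_prop)
    have h2 := MeasurableSet.iInter h
    convert h2 using 1
    ext E
    simp
  have hFE : ∀ E : Fin (n+1) → ℝ, (∀ i, 0 < E i) → ∀ b t', w b t' * E (F (D E) b) ≤ w b (F (D E) b) * E t' := by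
    intro E hE b
    have h : ∃ t, ∀ t', (D E) (some b) t t' = true := by
      obtain ⟨t, ht⟩ := Finite.exists_max (fun t => w b t / E t)
      refine ⟨t, fun t' => ?_⟩
      have := ht t'
      rw [div_le_div_iff₀ (hE _) (hE _)] at this
      exact (hDw E b t t').2 this
    have h2 : F (D E) b = h.choose := by simp only [hF]; rw [dif_pos h]
    rw [h2]
    intro t'
    have := h.choose_spec t'
    exact (hDw E b _ t').1 this
  have hrE : ∀ E : Fin (n+1) → ℝ, (∀ i, 0 < E i) → 
      ∀ t, r (D E) t + 1 ≤ (Finset.univ.filter fun t' => p t * E t' ≤ p t' * E t).card := by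
    intro E hE
    have h : ∃ r : Fin (n+1) → ℕ, Function.Injective r ∧
      ∀ t, r t + 1 ≤ (Finset.univ.filter fun t' => D E none t' t = true).card := by
      obtain ⟨r, h1, h2⟩ := exists_rank (fun t => p t / E t)
      refine ⟨r, h1, fun t => (h2 t).trans (le_of_eq ?_)⟩
      congr 1
      ext t'
      simp only [Finset.mem_filter, Finset.mem_univ, true_and]
      rw [div_le_div_iff₀ (hE _) (hE _), hDp]
    have h2 : r (D E) = h.choose := by simp only [hr]; rw [dif_pos h]
    rw [h2]
    intro t
    refine (h.choose_spec.2 t).trans (le_of_eq ?_)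
    congr 1
    ext t'
    simp only [Finset.mem_filter, Finset.mem_univ, true_and, hDp]
  have hrinj : ∀ u, Function.Injective (r u) := by
    intro u
    simp only [hr]
    split_ifs with h
    · exact h.choose_spec.1
    · exact Fin.val_injective
  set A : B → Fin (n+1) → Set (Fin (n+1) → ℝ) := fun b t => {E | F (D E) b = t} with hA
  set Fs : B → Fin (n+1) → Set (Fin (n+1) → ℝ) := fun b t => A b t ∩ {E | ∀ i, 0 < E i} with hFs
  have hAm : ∀ b t, MeasurableSet (A b t) := by
    intro b t
    have : Measurable (fun u : (Option B → Fin (n+1) → Fin (n+1) → Bool) => F u b) := measurable_of_finite _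
    exact (this.comp hDm) (measurableSet_singleton t)
  have hFsm : ∀ b t, MeasurableSet (Fs b t) := fun b t => (hAm b t).inter hPm
  have hAF : ∀ b t, Fs b t =ᵐ[nu n] A b t := by
    intro b t
    filter_upwards [hpos] with E hE
    apply propext
    exact ⟨fun h => h.1, fun h => ⟨h, hE⟩⟩
  have hcore : ∀ b t, 0 < w b t → ∀ E ∈ Fs b t, 0 < E t ∧ ∀ i, w b (t.succAbove i) / w b t * E t ≤ E (t.succAbove i) := by
    intro b t hwt E hE
    refine ⟨hE.2 t, fun i => ?_⟩
    have := hFE E hE.2 b (t.succAbove i)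
    have hh : F (D E) b = t := hE.1
    rw [hh] at this
    rw [div_mul_eq_mul_div, div_le_iff₀ hwt]
    linarith
  have hle : ∀ b t, (nu n).real (Fs b t) ≤ w b t := by
    intro b t
    rcases (hw b t).eq_or_lt with h0 | h0
    · have : Fs b t = ∅ := by
        ext E
        simp only [Set.mem_empty_iff_false, iff_false]
        intro hE
        have hh : F (D E) b = t := hE.1
        have : ∀ t', w b t' ≤ 0 := by
          intro t'
          have := hFE E hE.2 b t'
          rw [hh, ← h0, zero_mul] at this
          by_contra hc
          have := mul_pos (not_le.1 hc) (hE.2 t)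
          linarith
        have h2 := Finset.sum_nonpos fun i (_ : i ∈ Finset.univ) => this i
        rw [hw1] at h2
        linarith
      rw [this]; simp [← h0]
    · have h1 := race1 t (fun i => w b (t.succAbove i) / w b t) (fun _ => 1) (by fun_prop)
      have hcs : 1 + ∑ i, w b (t.succAbove i) / w b t = 1 / w b t := by
        rw [← Finset.sum_div]
        have := hw1 b
        rw [Fin.sum_univ_succAbove _ t] at this
        field_simp
        linarith
      have h2 := lint_exp (1 / w b t) (by positivity) 0
      simp only [mul_one, hcs, h2, lintegral_const, one_mul, Measure.restrict_apply_univ] at h1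
      refine ENNReal.toReal_le_of_le_ofReal h0.le ?_
      refine (measure_mono (fun E hE => (hcore b t h0 E hE).2)).trans (h1.trans ?_)
      simp
  have hsum : ∀ b, ∑ t, (nu n).real (Fs b t) = 1 := by
    intro b
    have h1 : ∀ t, (nu n).real (Fs b t) = (nu n).real ((fun E => F (D E) b) ⁻¹' {t}) :=
      fun t => measureReal_congr (hAF b t)
    simp only [h1]
    have : Measurable (fun u : (Option B → Fin (n+1) → Fin (n+1) → Bool) => F u b) := measurable_of_finite _
    have := disc_int (nu n) (fun E => F (D E) b) (this.comp hDm) (fun _ => 1)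
    simpa using this.symm
  have heq : ∀ b t, (nu n).real (Fs b t) = w b t := by
    intro b t
    have := (Finset.sum_eq_sum_iff_of_le (fun t (_ : t ∈ Finset.univ) => hle b t)).1 (by rw [hsum, hw1])
    exact this t (Finset.mem_univ _)
  refine ⟨_, inferInstance, fun u => (nu n).real (D ⁻¹' {u}), F, r, fun u => measureReal_nonneg, ?_, hrinj, ?_, ?_⟩
  · have := disc_int (nu n) D hDm (fun _ => 1)
    simpa using this.symm
  · intro b t
    have := disc_int (nu n) D hDm (fun u => if F u b = t then 1 else 0)
    rw [← this, ← heq b t, measureReal_congr (hAF b t), ← integral_indicator_one (hAm b t)]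
    refine integral_congr_ae (Filter.Eventually.of_forall fun E => ?_)
    by_cases hE : E ∈ A b t
    · rw [Set.indicator_of_mem hE]; exact if_pos hE
    · rw [Set.indicator_of_notMem hE]; exact if_neg hE
  · intro b t hpt hwt
    have := disc_int (nu n) D hDm (fun u => if F u b = t then Real.log (r u t + 1/4) else 0)
    rw [← this]
    have h2 : ∫ E, (if F (D E) b = t then Real.log (r (D E) t + 1/4) else 0) ∂(nu n)
        = ∫ E in Fs b t, Real.log (r (D E) t + 1/4) ∂(nu n) := by
      rw [setIntegral_congr_set (hAF b t), ← integral_indicator (hAm b t)]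
      refine integral_congr_ae (Filter.Eventually.of_forall fun E => ?_)
      by_cases hE : E ∈ A b t
      · rw [Set.indicator_of_mem hE]; exact if_pos hE
      · rw [Set.indicator_of_notMem hE]; exact if_neg hE
    rw [h2]
    have hjm : Measurable (fun u : (Option B → Fin (n+1) → Fin (n+1) → Bool) => r u t) := measurable_of_finite _
    refine race_core t (w b) p (hw b) (hw1 b) hp hp1 hwt hpt (Fs b t) (hFsm b t) (hcore b t hwt) (heq b t)
      (fun E => r (D E) t) (hjm.comp hDm) ?_
    intro E hE
    have h3 := hrE E hE.2 t
    rw [Finset.card_filter, Fin.sum_univ_succAbove _ t, if_pos le_rfl] at h3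
    have h4 : r (D E) t ≤ ∑ i, if p t * E (t.succAbove i) ≤ p (t.succAbove i) * E t then 1 else 0 := by omega
    have h5 : (r (D E) t : ℝ) ≤ ((∑ i, if p t * E (t.succAbove i) ≤ p (t.succAbove i) * E t then 1 else 0 : ℕ) : ℝ) := by
      exact_mod_cast h4
    refine h5.trans (le_of_eq ?_)
    push_cast
    refine Finset.sum_congr rfl fun i _ => ?_
    have : E (t.succAbove i) ≤ p (t.succAbove i) / p t * E t ↔ p t * E (t.succAbove i) ≤ p (t.succAbove i) * E t := by
      rw [div_mul_eq_mul_div, le_div_iff₀ hpt, mul_comm (p t)]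
    simp only [this]

open Classical in
lemma race_gen {𝒯 B : Type} [Fintype 𝒯] [Nonempty 𝒯] [Fintype B] (w : B → 𝒯 → ℝ) (p : 𝒯 → ℝ)
    (hw : ∀ b i, 0 ≤ w b i) (hw1 : ∀ b, ∑ i, w b i = 1)
    (hp : ∀ i, 0 ≤ p i) (hp1 : ∑ i, p i = 1) :
    ∃ (U : Type) (_ : Fintype U) (m : U → ℝ) (F : U → B → 𝒯) (r : U → 𝒯 → ℕ),
      (∀ u, 0 ≤ m u) ∧ ∑ u, m u = 1 ∧ (∀ u, Function.Injective (r u)) ∧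
      (∀ b t, ∑ u, (m u * if F u b = t then 1 else 0) = w b t) ∧
      ∀ b t, 0 < p t → 0 < w b t →
        ∑ u, (m u * if F u b = t then Real.log (r u t + 1/4) else 0) ≤
          w b t * (Real.log (w b t / p t) + 7/23 * (p t / w b t - 1)) := by
  obtain ⟨n, hn⟩ : ∃ n, Fintype.card 𝒯 = n + 1 :=
    Nat.exists_eq_succ_of_ne_zero Fintype.card_ne_zero
  let e : 𝒯 ≃ Fin (n+1) := Fintype.equivFinOfCardEq hn
  obtain ⟨U, hU, m, F, r, h1, h2, h3, h4, h5⟩ := race_fin (fun b i => w b (e.symm i)) (fun i => p (e.symm i))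
    (fun b i => hw b _) (fun b => by rw [Equiv.sum_comp e.symm (w b)]; exact hw1 b) (fun i => hp _)
    (by rw [Equiv.sum_comp e.symm p]; exact hp1)
  have hiff : ∀ u b t, (e.symm (F u b) = t) = (F u b = e t) := by
    intro u b t
    exact propext (Equiv.symm_apply_eq e)
  refine ⟨U, hU, m, fun u b => e.symm (F u b), fun u t => r u (e t), h1, h2,
    fun u => (h3 u).comp e.injective, ?_, ?_⟩
  · intro b t
    have := h4 b (e t)
    simp only [hiff]
    simpa using this
  · intro b t hp hw
    have := h5 b (e t) (by simpa using hp) (by simpa using hw)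
    simp only [hiff]
    simpa using this

lemma sfrl {C B 𝒯 : Type} [Fintype C] [Fintype B] [Fintype 𝒯] (P : C → ℝ) (hP : ∀ c, 0 ≤ P c)
    (hP1 : ∑ c, P c = 1) (b : C → B) (t : C → 𝒯) :
    ∃ (U : Type) (_ : Fintype U) (J : C × U → ℝ), (∀ z, 0 ≤ J z) ∧ (∀ c, ∑ u, J (c, u) = P c) ∧
      hf P b + hf J (fun z => z.2) ≤ hf J (fun z => (b z.1, z.2)) ∧
      hf J (fun z => (t z.1, z.2)) - hf J (fun z => z.2) ≤
        (hf P b + hf P t - hf P (fun c => (b c, t c))) +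
        (Real.log ((hf P b + hf P t - hf P (fun c => (b c, t c))) / Real.log 2 + 5.51) + 1.06 * Real.log 2) := by
  classical
  set I := hf P b + hf P t - hf P (fun c => (b c, t c)) with hI
  have hI0 : 0 ≤ I := by have := hf_subadd P hP hP1 b t; linarith
  set lb := law P b with hlb
  set p := law P t with hp
  set l := law P (fun c => (b c, t c)) with hl
  have nb : ∀ x, 0 ≤ lb x := law_nonneg P hP _
  have np : ∀ x, 0 ≤ p x := law_nonneg P hP _
  have nl : ∀ x, 0 ≤ l x := law_nonneg P hP _
  have hp1 : ∑ i, p i = 1 := by rw [hp, law_total, hP1]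
  have hb1 : ∑ i, lb i = 1 := by rw [hlb, law_total, hP1]
  have hlm : ∀ x, ∑ y, l (x, y) = lb x := by
    intro x
    have h1 := law_marg P t b x
    rw [hlb, ← h1]
    refine Finset.sum_congr rfl fun y _ => ?_
    rw [hl]
    unfold law
    refine Finset.sum_congr rfl fun c _ => ?_
    simp only [Prod.mk.injEq, and_comm]
  have hNE : Nonempty 𝒯 := by
    by_contra hne
    rw [not_nonempty_iff] at hne
    simp at hp1
  set w : B → 𝒯 → ℝ := fun x y => if lb x = 0 then p y else l (x, y) / lb x with hwdef
  have hw0 : ∀ x y, 0 ≤ w x y := by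
    intro x y
    simp only [hwdef]
    split_ifs
    · exact np y
    · exact div_nonneg (nl _) (nb _)
  have hw1 : ∀ x, ∑ y, w x y = 1 := by
    intro x
    simp only [hwdef]
    split_ifs with h
    · exact hp1
    · rw [← Finset.sum_div, hlm, div_self h]
  obtain ⟨U, hU, m, F, r, hm0, hm1, hrinj, hFw, hrace⟩ := race_gen w p hw0 hw1 np hp1
  set J : C × U → ℝ := fun z => P z.1 / l (b z.1, t z.1) * lb (b z.1) * (m z.2 * if F z.2 (b z.1) = t z.1 then 1 else 0) with hJ
  have hJ0 : ∀ z, 0 ≤ J z := by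
    intro z
    refine mul_nonneg (mul_nonneg (div_nonneg (hP _) (nl _)) (nb _)) (mul_nonneg (hm0 _) ?_)
    split_ifs <;> norm_num
  -- facts on the support
  have sl : ∀ c, 0 < P c → 0 < l (b c, t c) := fun c h => h.trans_le (le_law P hP (fun c => (b c, t c)) c)
  have sb : ∀ c, 0 < P c → 0 < lb (b c) := fun c h => h.trans_le (le_law P hP b c)
  have sp : ∀ c, 0 < P c → 0 < p (t c) := fun c h => h.trans_le (le_law P hP t c)
  have sw : ∀ c, 0 < P c → w (b c) (t c) = l (b c, t c) / lb (b c) := fun c h => if_neg (sb c h).ne'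
  have hJm : ∀ c, ∑ u, J (c, u) = P c := by
    intro c
    simp only [hJ]
    rw [← Finset.mul_sum, hFw]
    rcases (hP c).eq_or_lt with h0 | h0
    · simp [← h0]
    · rw [sw c h0]
      have := sl c h0
      have := sb c h0
      field_simp
  have hJ1 : ∑ z, J z = 1 := by
    rw [Fintype.sum_prod_type]; simp only [hJm]; exact hP1
  refine ⟨U, hU, J, hJ0, hJm, ?_, ?_⟩
  · -- independence
    have hlaw : ∀ z : B × U, law J (fun z => (b z.1, z.2)) z ≤ lb z.1 * m z.2 := by
      rintro ⟨x, u⟩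
      have e1 : law J (fun z => (b z.1, z.2)) (x, u) =
          ∑ c, P c * ((if b c = x then 1 else 0) / l (b c, t c) * lb (b c) * (m u * if F u (b c) = t c then 1 else 0)) := by
        unfold law
        rw [Fintype.sum_prod_type]
        refine Finset.sum_congr rfl fun c _ => ?_
        rw [Finset.sum_eq_single u]
        · by_cases h : b c = x
          · simp only [h, if_true, hJ]; ring
          · simp [h]
        · intro v _ hv
          rw [if_neg]
          intro h
          exact hv (Prod.ext_iff.1 h).2
        · simp
      rw [e1]
      have e2 := law_sum P (fun c => (b c, t c)) (fun z : B × 𝒯 => ((if z.1 = x then 1 else 0) / l z * lb z.1 * (m u * if F u z.1 = z.2 then 1 else 0)))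
      simp only at e2
      rw [← e2, Fintype.sum_prod_type, Finset.sum_eq_single x, Finset.sum_eq_single (F u x)]
      · simp only [if_true, mul_one]
        rw [← mul_assoc, ← mul_assoc, mul_one_div, ← hl]
        have := div_self_le_one (l (x, F u x))
        have h2 := mul_nonneg (nb x) (hm0 u)
        nlinarith
      · intro y _ hy
        have hne : ¬ (F u x = y) := fun h => hy h.symm
        simp [hne]
      · simp
      · intro x' _ hx
        simp [hx]
      · simp
    have hu := gibbs J hJ0 hJ1 (fun z => z.2) m hm0 hm1.le ?_
    · rw [← hf_fst P J hJm b]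
      refine (add_le_add_right hu _).trans ?_
      rw [hf_eq, hf_eq, ← neg_add, neg_le_neg_iff, ← Finset.sum_add_distrib]
      refine Finset.sum_le_sum fun z _ => ?_
      rcases (hJ0 z).eq_or_lt with h0 | h0
      · simp [← h0]
      · rw [← mul_add]
        refine mul_le_mul_of_nonneg_left ?_ h0.le
        have k1 := h0.trans_le (le_law J hJ0 (fun z => (b z.1, z.2)) z)
        have k2 := hlaw (b z.1, z.2)
        have k3 : law J (fun z => b z.1) (b z.1) = lb (b z.1) := by
          unfold law
          rw [hlb]
          unfold law
          rw [Fintype.sum_prod_type]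
          refine Finset.sum_congr rfl fun c _ => ?_
          by_cases h : b c = b z.1
          · simp [h, hJm]
          · simp [h]
        rw [k3]
        have k4 : 0 < lb (b z.1) * m z.2 := k1.trans_le k2
        have k5 : lb (b z.1) ≠ 0 := fun h => by simp [h] at k4
        have k6 : m z.2 ≠ 0 := fun h => by simp [h] at k4
        rw [← Real.log_mul k5 k6]
        exact Real.log_le_log k1 k2
    · intro z hz
      refine (hm0 _).lt_of_ne fun h => ?_
      simp [hJ, ← h] at hz
  · obtain ⟨δ, hδ, hnum⟩ := numeric_delta I hI0
    have hS0 : 0 < Sd δ := by unfold Sd; positivity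
    set lu := law J (fun z => z.2) with hlu
    have nu0 : ∀ u, 0 ≤ lu u := law_nonneg J hJ0 _
    have hu1 : ∑ u, lu u = 1 := by rw [hlu, law_total, hJ1]
    have hg := gibbs J hJ0 hJ1 (fun z => (t z.1, z.2))
      (fun a => lu a.2 * ((r a.2 a.1 + 1/4 : ℝ) ^ (-1-δ) / Sd δ))
      (fun a => mul_nonneg (nu0 _) (by positivity)) ?_ ?_
    · have hsum : ∑ z, J z * Real.log (r z.2 (t z.1) + 1/4) ≤ I := by
        rw [Fintype.sum_prod_type]
        have s1 : ∀ c, ∑ u, J (c, u) * Real.log (r u (t c) + 1/4) ≤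
            P c * (Real.log (l (b c, t c)) - Real.log (lb (b c)) - Real.log (p (t c)))
             + 7/23 * (P c * (p (t c) * lb (b c) / l (b c, t c)) - P c) := by
          intro c
          rcases (hP c).eq_or_lt with h0 | h0
          · simp [hJ, ← h0]
          · have a1 := sl c h0
            have a2 := sb c h0
            have a3 := sp c h0
            have a4 := sw c h0
            have a5 : 0 < w (b c) (t c) := by rw [a4]; positivity
            have hr := hrace (b c) (t c) a3 a5
            have e : ∑ u, J (c, u) * Real.log (r u (t c) + 1/4) =
                P c / l (b c, t c) * lb (b c) * ∑ u, (m u * if F u (b c) = t c then Real.log (r u (t c) + 1/4) else 0) := by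
              rw [Finset.mul_sum]
              refine Finset.sum_congr rfl fun u _ => ?_
              simp only [hJ]
              split_ifs <;> ring
            rw [e]
            refine (mul_le_mul_of_nonneg_left hr (by positivity)).trans (le_of_eq ?_)
            rw [a4, Real.log_div (by positivity) a3.ne', Real.log_div a1.ne' a2.ne']
            field_simp
        refine (Finset.sum_le_sum fun c _ => s1 c).trans ?_
        rw [Finset.sum_add_distrib, ← Finset.mul_sum, Finset.sum_sub_distrib, hP1]
        have s2 : ∑ c, P c * (Real.log (l (b c, t c)) - Real.log (lb (b c)) - Real.log (p (t c))) = I := by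
          rw [hI, hf_eq, hf_eq, hf_eq]
          simp only [mul_sub, Finset.sum_sub_distrib]
          ring
        have s3 : ∑ c, P c * (p (t c) * lb (b c) / l (b c, t c)) ≤ 1 := by
          have e2 := law_sum P (fun c => (b c, t c)) (fun z : B × 𝒯 => p z.2 * lb z.1 / l z)
          simp only at e2
          rw [← e2]
          calc _ ≤ ∑ z : B × 𝒯, lb z.1 * p z.2 := by
                refine Finset.sum_le_sum fun z _ => ?_
                rw [← hl]
                rcases (nl z).eq_or_lt with h0 | h0
                · rw [← h0]; simpa using mul_nonneg (nb _) (np _)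
                · rw [mul_div_cancel₀ _ h0.ne', mul_comm]
            _ = 1 := by
                rw [Fintype.sum_prod_type]
                simp only [← Finset.mul_sum, hp1, mul_one, hb1]
        rw [s2]
        linarith
      have hexp : - ∑ z, J z * Real.log (lu z.2 * ((r z.2 (t z.1) + 1/4 : ℝ) ^ (-1-δ) / Sd δ)) =
          hf J (fun z => z.2) + (1+δ) * (∑ z, J z * Real.log (r z.2 (t z.1) + 1/4)) + Real.log (Sd δ) := by
        have : ∀ z, J z * Real.log (lu z.2 * ((r z.2 (t z.1) + 1/4 : ℝ) ^ (-1-δ) / Sd δ)) =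
            J z * Real.log (lu z.2) - (1+δ) * (J z * Real.log (r z.2 (t z.1) + 1/4)) - J z * Real.log (Sd δ) := by
          intro z
          rcases (hJ0 z).eq_or_lt with h0 | h0
          · simp [← h0]
          · have k := h0.trans_le (le_law J hJ0 (fun z => z.2) z)
            rw [Real.log_mul k.ne' (by positivity), Real.log_div (by positivity) hS0.ne',
              Real.log_rpow (by positivity)]
            ring
        simp only [this]
        rw [Finset.sum_sub_distrib, Finset.sum_sub_distrib, ← Finset.sum_mul, hJ1, ← Finset.mul_sum, hf_eq]
        ring
      simp only at hg
      rw [hexp] at hg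
      have := mul_le_mul_of_nonneg_left hsum (by linarith : 0 ≤ 1 + δ)
      linarith
    · rw [Fintype.sum_prod_type, Finset.sum_comm]
      calc _ ≤ ∑ u, lu u * 1 := by
            refine Finset.sum_le_sum fun u _ => ?_
            simp only
            rw [← Finset.mul_sum, ← Finset.sum_div]
            refine mul_le_mul_of_nonneg_left ?_ (nu0 u)
            rw [div_le_one hS0]
            exact sum_rank_le (r u) (hrinj u) hδ
        _ ≤ 1 := by simp [hu1]
    · intro z hz
      have k := hz.trans_le (le_law J hJ0 (fun z => z.2) z)
      exact mul_pos k (by positivity)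

open Classical in
lemma law_pair {C α Y : Type*} [Fintype C] [Fintype Y] (K : C × Y → ℝ) (f : C → α) (a : α) (y : Y) :
    law K (fun z => (f z.1, z.2)) (a, y) = ∑ c, if f c = a then K (c, y) else 0 := by
  unfold law
  rw [Fintype.sum_prod_type]
  refine Finset.sum_congr rfl fun c _ => ?_
  rw [Finset.sum_eq_single y]
  · by_cases h : f c = a <;> simp [h]
  · intro v _ hv
    rw [if_neg]
    intro h
    exact hv (Prod.ext_iff.1 h).2
  · simp

lemma mix_hf {C α ι : Type*} [Fintype C] [Fintype α] [Fintype ι] (U : ι → Type*) [∀ j, Fintype (U j)]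
    (J : ∀ j, C × U j → ℝ) (w : ι → ℝ) (hJ1 : ∀ j, ∑ z, J j z = 1) (f : C → α) :
    hf (fun z : C × (Σ j, U j) => w z.2.1 * J z.2.1 (z.1, z.2.2)) (fun z => (f z.1, z.2)) =
      ∑ j, Real.negMulLog (w j) + ∑ j, w j * hf (J j) (fun z => (f z.1, z.2)) := by
  classical
  have hl : ∀ a (j : ι) (u : U j), law (fun z : C × (Σ j, U j) => w z.2.1 * J z.2.1 (z.1, z.2.2))
      (fun z => (f z.1, z.2)) (a, ⟨j, u⟩) = w j * law (J j) (fun z => (f z.1, z.2)) (a, u) := by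
    intro a j u
    rw [law_pair, law_pair, Finset.mul_sum]
    refine Finset.sum_congr rfl fun c _ => ?_
    by_cases h : f c = a <;> simp [h]
  rw [← Finset.sum_add_distrib]
  unfold hf
  rw [Fintype.sum_prod_type]
  simp only [Fintype.sum_sigma, hl, Real.negMulLog_mul]
  rw [Finset.sum_comm]
  refine Finset.sum_congr rfl fun j _ => ?_
  simp only [Finset.sum_add_distrib, ← Finset.sum_mul, ← Finset.mul_sum]
  have h1 : ∑ a, ∑ u, law (J j) (fun z => (f z.1, z.2)) (a, u) = 1 := by
    rw [← hJ1 j, ← law_total (J j) (fun z => (f z.1, z.2)), Fintype.sum_prod_type]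
  rw [h1, one_mul]
  congr 2
  rw [Fintype.sum_prod_type]

lemma real_bridge {Ω C α : Type*} [MeasurableSpace Ω] (μ : Measure Ω) [IsFiniteMeasure μ] [Fintype C]
    (Z : Ω → C) (hZ : ∀ c, MeasurableSet (Z ⁻¹' {c})) (f : C → α) (a : α) :
    (μ ((fun ω => f (Z ω)) ⁻¹' {a})).toReal = law (fun c => (μ (Z ⁻¹' {c})).toReal) f a := by
  classical
  have h1 : (fun ω => f (Z ω)) ⁻¹' {a} = ⋃ c ∈ Finset.univ.filter (fun c => f c = a), Z ⁻¹' {c} := by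
    ext ω
    simp
  have h2 := measureReal_biUnion_finset (μ := μ) (s := Finset.univ.filter (fun c => f c = a)) (f := fun c => Z ⁻¹' {c})
    (fun c _ d _ hcd => Disjoint.preimage _ (by simpa using hcd)) (fun c _ => hZ c)
  rw [h1]
  change μ.real _ = _
  rw [h2, Finset.sum_filter]
  unfold law
  refine Finset.sum_congr rfl fun c _ => ?_
  by_cases h : f c = a <;> simp [h, measureReal_def]

lemma ent_bridge {Ω C α : Type*} [MeasurableSpace Ω] (μ : Measure Ω) [IsFiniteMeasure μ] [Fintype C] [Fintype α]
    (Z : Ω → C) (hZ : ∀ c, MeasurableSet (Z ⁻¹' {c})) (f : C → α) :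
    ent μ (fun ω => f (Z ω)) = hf (fun c => (μ (Z ⁻¹' {c})).toReal) f / Real.log 2 := by
  unfold ent hf
  rw [Finset.sum_div]
  refine Finset.sum_congr rfl fun a _ => ?_
  rw [real_bridge μ Z hZ f a, Real.negMulLog, Real.logb]
  ring

lemma fin_main {C 𝒮 𝒳 𝒯 : Type} [Fintype C] [Fintype 𝒮] [Fintype 𝒳] [Fintype 𝒯] (P : C → ℝ)
    (hP : ∀ c, 0 ≤ P c) (hP1 : ∑ c, P c = 1) (s : C → 𝒮) (x : C → 𝒳) (t : C → 𝒯)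
    (α β : ℝ) (hα0 : 0 ≤ α) (hα1 : α ≤ 1) (hβ0 : 0 ≤ β) (hβ1 : β ≤ 1) :
    ∃ (Y : Type) (_ : Fintype Y) (K : C × Y → ℝ), (∀ z, 0 ≤ K z) ∧ (∀ c, ∑ y, K (c, y) = P c) ∧
      hf K (fun z => z.2) + hf P s - hf K (fun z => (z.2, s z.1)) ≤
        α * (1-β) * (hf P (fun c => (x c, s c)) - hf P x) + α * β * hf P (fun c => (x c, s c)) ∧
      hf P x + hf K (fun z => z.2) - hf K (fun z => (x z.1, z.2)) ≤ α * β * hf P x ∧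
      (1-α) * (hf P t - (hf P (fun c => (x c, s c)) + hf P t - hf P (fun c => ((x c, s c), t c)))
          - Real.log ((hf P (fun c => (x c, s c)) + hf P t - hf P (fun c => ((x c, s c), t c))) / Real.log 2 + 5.51))
        + α * (1-β) * (hf P t - (hf P x + hf P t - hf P (fun c => (x c, t c)))
          - Real.log ((hf P x + hf P t - hf P (fun c => (x c, t c))) / Real.log 2 + 5.51))
        + α * β * (hf P t - Real.log 5.51) - 1.06 * Real.log 2 ≤
        hf K (fun z => z.2) + hf P t - hf K (fun z => (z.2, t z.1)) := by
  classical
  set bb : Fin 3 → C → Option 𝒳 × Option 𝒮 :=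
    ![fun c => (some (x c), some (s c)), fun c => (some (x c), none), fun _ => (none, none)] with hbb
  choose U hU J hJ0 hJm hJi hJu using fun j => sfrl P hP hP1 (bb j) t
  set w : Fin 3 → ℝ := ![1-α, α*(1-β), α*β] with hw
  have hw0 : ∀ j, 0 ≤ w j := by
    intro j
    fin_cases j
    · exact sub_nonneg.2 hα1
    · exact mul_nonneg hα0 (sub_nonneg.2 hβ1)
    · exact mul_nonneg hα0 hβ0
  have hw1 : w 0 + w 1 + w 2 = 1 := by simp [hw]; ring
  have hJ1 : ∀ j, ∑ z, J j z = 1 := by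
    intro j
    rw [Fintype.sum_prod_type]; simp only [hJm]; exact hP1
  set K : C × (Σ j, U j) → ℝ := fun z => w z.2.1 * J z.2.1 (z.1, z.2.2) with hK
  have hK0 : ∀ z, 0 ≤ K z := fun z => mul_nonneg (hw0 _) (hJ0 _ _)
  have hKm : ∀ c, ∑ y, K (c, y) = P c := by
    intro c
    simp only [hK, Fintype.sum_sigma, ← Finset.mul_sum, hJm]
    rw [← Finset.sum_mul, Fin.sum_univ_three, hw1, one_mul]
  have hy : hf K (fun z => z.2) = ∑ j, Real.negMulLog (w j) + ∑ j, w j * hf (J j) (fun z => z.2) := by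
    have h1 := mix_hf U J w hJ1 (fun _ => ())
    rw [hf_congr K hK0 (fun z => z.2) (fun z => ((), z.2)) (by simp), hK, h1]
    congr 1
    refine Finset.sum_congr rfl fun j _ => ?_
    rw [hf_congr (J j) (hJ0 j) (fun z => z.2) (fun z => ((), z.2)) (by simp)]
  have hs := mix_hf U J w hJ1 s
  have hx := mix_hf U J w hJ1 x
  have ht := mix_hf U J w hJ1 t
  rw [← hK] at hs hx ht
  rw [Fin.sum_univ_three, Fin.sum_univ_three] at hy hs hx ht
  have hts : hf K (fun z => (z.2, t z.1)) = hf K (fun z => (t z.1, z.2)) :=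
    hf_congr K hK0 _ _ (by simp [and_comm])
  have hss : hf K (fun z => (z.2, s z.1)) = hf K (fun z => (s z.1, z.2)) :=
    hf_congr K hK0 _ _ (by simp [and_comm])
  -- generic inequalities per mode
  have gX : ∀ j, hf P x = hf (J j) (fun z => x z.1) := fun j => (hf_fst P (J j) (hJm j) x).symm
  have gS : ∀ j, hf P s = hf (J j) (fun z => s z.1) := fun j => (hf_fst P (J j) (hJm j) s).symm
  have gXS : ∀ j, hf P (fun c => (x c, s c)) = hf (J j) (fun z => (x z.1, s z.1)) :=
    fun j => (hf_fst P (J j) (hJm j) (fun c => (x c, s c))).symm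
  have subS : ∀ j, hf (J j) (fun z => ((x z.1, s z.1), z.2)) + hf P s ≤
      hf P (fun c => (x c, s c)) + hf (J j) (fun z => (s z.1, z.2)) := by
    intro j
    have h := hf_submod (J j) (hJ0 j) (hJ1 j) (fun z => x z.1) (fun z => z.2) (fun z => s z.1)
    rw [gS j, gXS j]
    rw [hf_congr (J j) (hJ0 j) (fun z => ((x z.1, s z.1), z.2)) (fun z => (x z.1, z.2, s z.1)) (by simp; tauto),
      hf_congr (J j) (hJ0 j) (fun z => (s z.1, z.2)) (fun z => (z.2, s z.1)) (by simp [and_comm])]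
    exact h
  have subX : ∀ j, hf (J j) (fun z => ((x z.1, s z.1), z.2)) + hf P x ≤
      hf P (fun c => (x c, s c)) + hf (J j) (fun z => (x z.1, z.2)) := by
    intro j
    have h := hf_submod (J j) (hJ0 j) (hJ1 j) (fun z => s z.1) (fun z => z.2) (fun z => x z.1)
    rw [gX j, gXS j]
    rw [hf_congr (J j) (hJ0 j) (fun z => ((x z.1, s z.1), z.2)) (fun z => (s z.1, z.2, x z.1)) (by simp; tauto),
      hf_congr (J j) (hJ0 j) (fun z => (x z.1, z.2)) (fun z => (z.2, x z.1)) (by simp [and_comm]),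
      hf_congr (J j) (hJ0 j) (fun z => (x z.1, s z.1)) (fun z => (s z.1, x z.1)) (by simp [and_comm])]
    exact h
  -- mode 0
  have b0 : hf P (bb 0) = hf P (fun c => (x c, s c)) := hf_congr P hP _ _ (by simp [hbb])
  have b0u : hf (J 0) (fun z => (bb 0 z.1, z.2)) = hf (J 0) (fun z => ((x z.1, s z.1), z.2)) :=
    hf_congr _ (hJ0 0) _ _ (by simp [hbb])
  have b0t : hf P (fun c => (bb 0 c, t c)) = hf P (fun c => ((x c, s c), t c)) := hf_congr P hP _ _ (by simp [hbb])
  have b1 : hf P (bb 1) = hf P x := hf_congr P hP _ _ (by simp [hbb])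
  have b1u : hf (J 1) (fun z => (bb 1 z.1, z.2)) = hf (J 1) (fun z => (x z.1, z.2)) :=
    hf_congr _ (hJ0 1) _ _ (by simp [hbb])
  have b1t : hf P (fun c => (bb 1 c, t c)) = hf P (fun c => (x c, t c)) := hf_congr P hP _ _ (by simp [hbb])
  have b2 : hf P (bb 2) = 0 := by rw [← hf_const P hP1]; exact hf_congr P hP _ _ (by simp [hbb])
  have b2t : hf P (fun c => (bb 2 c, t c)) = hf P t := hf_congr P hP _ _ (by simp [hbb])
  have i0 := hJi 0
  have i1 := hJi 1
  have u0 := hJu 0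
  have u1 := hJu 1
  have u2 := hJu 2
  rw [b0, b0u] at i0
  rw [b1, b1u] at i1
  rw [b0, b0t] at u0
  rw [b1, b1t] at u1
  rw [b2, b2t, zero_add, sub_self, zero_div, zero_add, zero_add] at u2
  have e0 := subS 0
  have f0 := subX 0
  have e1 := subS 1
  have f1 := subX 1
  have m1 : hf (J 1) (fun z => (x z.1, z.2)) ≤ hf (J 1) (fun z => ((x z.1, s z.1), z.2)) :=
    hf_mono _ (hJ0 1) _ _ (by simp; tauto)
  have m2 : hf (J 2) (fun z => z.2) ≤ hf (J 2) (fun z => (s z.1, z.2)) := hf_mono _ (hJ0 2) _ _ (by simp)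
  have m3 : hf (J 2) (fun z => z.2) ≤ hf (J 2) (fun z => (x z.1, z.2)) := hf_mono _ (hJ0 2) _ _ (by simp)
  have m4 : hf P s ≤ hf P (fun c => (x c, s c)) := hf_mono P hP _ _ (by simp)
  have w0 : w 0 = 1 - α := rfl
  have w1 : w 1 = α * (1-β) := rfl
  have w2 : w 2 = α * β := rfl
  have sumw : ∀ a : ℝ, a = w 0 * a + w 1 * a + w 2 * a := fun a => by rw [← add_mul, ← add_mul, hw1, one_mul]
  refine ⟨_, inferInstance, K, hK0, hKm, ?_, ?_, ?_⟩
  · have q0 : hf (J 0) (fun z => z.2) + hf P s - hf (J 0) (fun z => (s z.1, z.2)) ≤ 0 := by linarith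
    have q1 : hf (J 1) (fun z => z.2) + hf P s - hf (J 1) (fun z => (s z.1, z.2)) ≤ hf P (fun c => (x c, s c)) - hf P x := by linarith
    have q2 : hf (J 2) (fun z => z.2) + hf P s - hf (J 2) (fun z => (s z.1, z.2)) ≤ hf P (fun c => (x c, s c)) := by linarith
    have r0 := mul_le_mul_of_nonneg_left q0 (hw0 0)
    have r1 := mul_le_mul_of_nonneg_left q1 (hw0 1)
    have r2 := mul_le_mul_of_nonneg_left q2 (hw0 2)
    have := sumw (hf P s)
    rw [hss, hs, hy, ← w1, ← w2]
    linarith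
  · have q0 : hf P x + hf (J 0) (fun z => z.2) - hf (J 0) (fun z => (x z.1, z.2)) ≤ 0 := by linarith
    have q1 : hf P x + hf (J 1) (fun z => z.2) - hf (J 1) (fun z => (x z.1, z.2)) ≤ 0 := by linarith
    have q2 : hf P x + hf (J 2) (fun z => z.2) - hf (J 2) (fun z => (x z.1, z.2)) ≤ hf P x := by linarith
    have r0 := mul_le_mul_of_nonneg_left q0 (hw0 0)
    have r1 := mul_le_mul_of_nonneg_left q1 (hw0 1)
    have r2 := mul_le_mul_of_nonneg_left q2 (hw0 2)
    have := sumw (hf P x)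
    rw [hx, hy, ← w2]
    linarith
  · have r0 := mul_le_mul_of_nonneg_left u0 (hw0 0)
    have r1 := mul_le_mul_of_nonneg_left u1 (hw0 1)
    have r2 := mul_le_mul_of_nonneg_left u2 (hw0 2)
    have := sumw (hf P t)
    have := sumw (1.06 * Real.log 2)
    rw [hts, ht, hy, ← w1, ← w2, ← w0]
    linarith

lemma log_tangent {a M : ℝ} (ha : 0 < a) (hM : 0 < M) : Real.log a ≤ Real.log M + a / M - 1 := by
  have := Real.log_le_sub_one_of_pos (div_pos ha hM)
  rw [Real.log_div ha.ne' hM.ne'] at this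
  linarith

lemma util_arith (HT HX HA HAT HXT r ε α β : ℝ) (hα0 : 0 ≤ α) (hα1 : α ≤ 1) (hβ0 : 0 ≤ β) (hβ1 : β ≤ 1)
    (hβ : β * HX = r) (hα : α * (HA - HX + r) = ε) (hI0 : 0 ≤ HA + HT - HAT) (hI1 : 0 ≤ HX + HT - HXT)
    (hTXT : HT ≤ HXT) (hXXT : HX ≤ HXT) (hXA : HX ≤ HA) (hT : 0 ≤ HT) (hA : 0 ≤ HA) :
    (HAT - HA) + ε - α * (HAT - HT) - 1.06
       - Real.logb 2 ((1-α) * (HA + HT - HAT) + α * min HT HA + 5.51) ≤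
     (1-α) * (HT - (HA + HT - HAT) - Real.logb 2 (HA + HT - HAT + 5.51))
      + α * (1-β) * (HT - (HX + HT - HXT) - Real.logb 2 (HX + HT - HXT + 5.51))
      + α * β * (HT - Real.logb 2 5.51) - 1.06 := by
  have hm0 : 0 ≤ min HT HA := le_min hT hA
  have hm1 : HX + HT - HXT ≤ min HT HA := le_min (by linarith) (by linarith)
  set M := (1-α) * (HA + HT - HAT) + α * min HT HA + 5.51 with hM
  have a0 : 0 ≤ 1 - α := by linarith
  have a1 : 0 ≤ α * (1-β) := mul_nonneg hα0 (by linarith)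
  have a2 : 0 ≤ α * β := mul_nonneg hα0 hβ0
  have hM0 : 0 < M := by
    have := mul_nonneg a0 hI0
    have := mul_nonneg hα0 hm0
    linarith
  have l2 : 0 < Real.log 2 := Real.log_pos (by norm_num)
  have hJ : (1-α) * Real.logb 2 (HA + HT - HAT + 5.51) + α * (1-β) * Real.logb 2 (HX + HT - HXT + 5.51)
      + α * β * Real.logb 2 5.51 ≤ Real.logb 2 M := by
    have t0 := mul_le_mul_of_nonneg_left (log_tangent (a := HA + HT - HAT + 5.51) (by linarith) hM0) a0
    have t1 := mul_le_mul_of_nonneg_left (log_tangent (a := HX + HT - HXT + 5.51) (by linarith) hM0) a1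
    have t2 := mul_le_mul_of_nonneg_left (log_tangent (a := 5.51) (by norm_num) hM0) a2
    have t3 : ((1-α) * (HA + HT - HAT + 5.51) + α * (1-β) * (HX + HT - HXT + 5.51) + α * β * 5.51) / M ≤ 1 := by
      rw [div_le_one hM0, hM]
      have := mul_le_mul_of_nonneg_left hm1 a1
      have := mul_nonneg a2 hm0
      linarith
    unfold Real.logb
    rw [← mul_div_assoc, ← mul_div_assoc, ← mul_div_assoc, ← add_div, ← add_div]
    gcongr
    rw [add_div, add_div] at t3
    have e : ∀ w a : ℝ, w * (Real.log M + a / M - 1) = w * Real.log M + w * a / M - w := by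
      intro w a; ring
    rw [e] at t0 t1 t2
    have : (1-α) * Real.log M + α * (1-β) * Real.log M + α * β * Real.log M = Real.log M := by ring
    linarith
  have hlin : α * (1-β) * (HX + HT - HXT) ≤ α * (1-β) * HX := mul_le_mul_of_nonneg_left (by linarith) a1
  have h3 : α * (1-β) * HX = α * HX - α * r := by rw [← hβ]; ring
  rw [← hα]
  linarith


/-- **Lower bound `L₄^{r,ε}` of Theorem 2.** For `0 ≤ r < min{I(S;X), H(X)}`, `r ≤ ε ≤ H(S|X) + r` and `α̃ = ε / (H(S|X) + r)`, there is a representation `Y` with `I(Y;S') ≤ ε`, `I(X';Y) ≤ r`, and `I(Y;T') ≥ H(T|(X,S)) + ε − α̃ H((X,S)|T) − 1.06 − log₂((1−α̃) I((X,S);T) + α̃ min{H(T), H(X,S)} + 5.51)`. -/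
theorem lower_bound_L4re
    {Ω 𝒮 𝒳 𝒯 : Type} [MeasurableSpace Ω] (μ : Measure Ω) [IsProbabilityMeasure μ]
    [Fintype 𝒮] [MeasurableSpace 𝒮] [MeasurableSingletonClass 𝒮]
    [Fintype 𝒳] [MeasurableSpace 𝒳] [MeasurableSingletonClass 𝒳]
    [Fintype 𝒯] [MeasurableSpace 𝒯] [MeasurableSingletonClass 𝒯]
    (S : Ω → 𝒮) (X : Ω → 𝒳) (T : Ω → 𝒯)
    (hS : Measurable S) (hX : Measurable X) (hT : Measurable T)
    (r : ℝ) (hr0 : 0 ≤ r) (hr1 : r < min (mutInf μ S X) (ent μ X))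
    (ε : ℝ) (hε0 : r ≤ ε) (hε1 : ε ≤ condEnt μ S X + r) :
    ∃ (Ω' : Type) (_ : MeasurableSpace Ω') (μ' : Measure Ω')
      (𝒴 : Type) (_ : Fintype 𝒴) (_ : MeasurableSpace 𝒴)
      (S' : Ω' → 𝒮) (X' : Ω' → 𝒳) (T' : Ω' → 𝒯) (Y : Ω' → 𝒴),
      IsProbabilityMeasure μ' ∧
      Measurable S' ∧ Measurable X' ∧ Measurable T' ∧ Measurable Y ∧
      IdentDistrib (fun ω => (S ω, X ω, T ω)) (fun ω => (S' ω, X' ω, T' ω)) μ μ' ∧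
      mutInf μ' Y S' ≤ ε ∧ mutInf μ' X' Y ≤ r ∧
      mutInf μ' Y T' ≥
        condEnt μ T (fun ω => (X ω, S ω)) + ε
          - (ε / (condEnt μ S X + r)) * condEnt μ (fun ω => (X ω, S ω)) T - 1.06
          - Real.logb 2 ((1 - ε / (condEnt μ S X + r)) * mutInf μ (fun ω => (X ω, S ω)) T
              + (ε / (condEnt μ S X + r)) * min (ent μ T) (ent μ (fun ω => (X ω, S ω))) + 5.51) := by
  classical
  have l2 : 0 < Real.log 2 := Real.log_pos (by norm_num)
  set Z : Ω → 𝒮 × 𝒳 × 𝒯 := fun ω => (S ω, X ω, T ω) with hZ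
  have hZm : Measurable Z := hS.prodMk (hX.prodMk hT)
  have hZs : ∀ c, MeasurableSet (Z ⁻¹' {c}) := fun c => hZm (measurableSet_singleton c)
  set P : 𝒮 × 𝒳 × 𝒯 → ℝ := fun c => (μ (Z ⁻¹' {c})).toReal with hPdef
  have hP : ∀ c, 0 ≤ P c := fun c => ENNReal.toReal_nonneg
  have hP1 : ∑ c, P c = 1 := by
    have h := disc_int μ Z hZm (fun _ => 1)
    simpa [measureReal_def] using h.symm
  set s : 𝒮 × 𝒳 × 𝒯 → 𝒮 := fun c => c.1 with hs
  set x : 𝒮 × 𝒳 × 𝒯 → 𝒳 := fun c => c.2.1 with hx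
  set t : 𝒮 × 𝒳 × 𝒯 → 𝒯 := fun c => c.2.2 with ht
  have eS : ent μ S = hf P s / Real.log 2 := ent_bridge μ Z hZs s
  have eX : ent μ X = hf P x / Real.log 2 := ent_bridge μ Z hZs x
  have eT : ent μ T = hf P t / Real.log 2 := ent_bridge μ Z hZs t
  have eXS : ent μ (fun ω => (X ω, S ω)) = hf P (fun c => (x c, s c)) / Real.log 2 :=
    ent_bridge μ Z hZs (fun c => (x c, s c))
  have eSX : ent μ (fun ω => (S ω, X ω)) = hf P (fun c => (x c, s c)) / Real.log 2 := by
    rw [hf_congr P hP (fun c => (x c, s c)) (fun c => (s c, x c)) (by simp [and_comm])]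
    exact ent_bridge μ Z hZs (fun c => (s c, x c))
  have eXST : ent μ (fun ω => ((X ω, S ω), T ω)) = hf P (fun c => ((x c, s c), t c)) / Real.log 2 :=
    ent_bridge μ Z hZs (fun c => ((x c, s c), t c))
  have eTXS : ent μ (fun ω => (T ω, (X ω, S ω))) = hf P (fun c => ((x c, s c), t c)) / Real.log 2 := by
    rw [hf_congr P hP (fun c => ((x c, s c), t c)) (fun c => (t c, (x c, s c))) (by simp; tauto)]
    exact ent_bridge μ Z hZs (fun c => (t c, (x c, s c)))
  simp only [condEnt, mutInf] at hr1 hε1 ⊢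
  rw [eSX] at hε1 hr1
  rw [eSX, eTXS, eXST, eXS, eT]
  rw [eX] at hε1 hr1 ⊢
  -- basic facts in bits
  have fXT : hf P t ≤ hf P (fun c => (x c, t c)) := hf_mono P hP _ _ (by simp)
  have fXT2 : hf P x ≤ hf P (fun c => (x c, t c)) := hf_mono P hP _ _ (by simp; tauto)
  have fXA : hf P x ≤ hf P (fun c => (x c, s c)) := hf_mono P hP _ _ (by simp; tauto)
  have fI0 := hf_subadd P hP hP1 (fun c => (x c, s c)) t
  have fI1 := hf_subadd P hP hP1 x t
  have fT := hf_nonneg P hP hP1 t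
  have fA := hf_nonneg P hP hP1 (fun c => (x c, s c))
  set HT := hf P t / Real.log 2 with hHT
  set HX := hf P x / Real.log 2 with hHX
  set HA := hf P (fun c => (x c, s c)) / Real.log 2 with hHA
  set HAT := hf P (fun c => ((x c, s c), t c)) / Real.log 2 with hHAT
  set HXT := hf P (fun c => (x c, t c)) / Real.log 2 with hHXT
  have kT : hf P t = HT * Real.log 2 := by rw [hHT]; field_simp
  have kX : hf P x = HX * Real.log 2 := by rw [hHX]; field_simp
  have kA : hf P (fun c => (x c, s c)) = HA * Real.log 2 := by rw [hHA]; field_simp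
  have kAT : hf P (fun c => ((x c, s c), t c)) = HAT * Real.log 2 := by rw [hHAT]; field_simp
  have kXT : hf P (fun c => (x c, t c)) = HXT * Real.log 2 := by rw [hHXT]; field_simp
  have gXT : HT ≤ HXT := by rw [hHT, hHXT]; gcongr
  have gXT2 : HX ≤ HXT := by rw [hHX, hHXT]; gcongr
  have gXA : HX ≤ HA := by rw [hHX, hHA]; gcongr
  have gI0 : 0 ≤ HA + HT - HAT := by
    rw [hHA, hHT, hHAT, ← add_div, ← sub_div]
    exact div_nonneg (by linarith) l2.le
  have gI1 : 0 ≤ HX + HT - HXT := by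
    rw [hHX, hHT, hHXT, ← add_div, ← sub_div]
    exact div_nonneg (by linarith) l2.le
  have gT : 0 ≤ HT := by rw [hHT]; positivity
  have gA : 0 ≤ HA := by rw [hHA]; positivity
  have hrX : r < HX := lt_of_lt_of_le hr1 (min_le_right _ _)
  have hX0 : 0 < HX := by linarith
  set α := ε / (HA - HX + r) with hαdef
  set β := r / HX with hβdef
  have hden : 0 ≤ HA - HX + r := by linarith
  have hε : 0 ≤ ε := by linarith
  have hα0 : 0 ≤ α := div_nonneg hε hden
  have hα1 : α ≤ 1 := div_le_one_of_le₀ hε1 hden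
  have hβ0 : 0 ≤ β := div_nonneg hr0 hX0.le
  have hβ1 : β ≤ 1 := div_le_one_of_le₀ hrX.le hX0.le
  have hβ : β * HX = r := div_mul_cancel₀ _ hX0.ne'
  have hα : α * (HA - HX + r) = ε := by
    rcases hden.eq_or_lt with h | h
    · rw [← h]; linarith
    · exact div_mul_cancel₀ _ h.ne'
  obtain ⟨𝒴, hY, K, hK0, hKm, hl1, hl2, hu⟩ := fin_main P hP hP1 s x t α β hα0 hα1 hβ0 hβ1
  have hK1 : ∑ z, K z = 1 := by rw [Fintype.sum_prod_type]; simp only [hKm]; exact hP1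
  let mY : MeasurableSpace 𝒴 := ⊤
  let mO : MeasurableSpace ((𝒮 × 𝒳 × 𝒯) × 𝒴) := ⊤
  let μ' : Measure ((𝒮 × 𝒳 × 𝒯) × 𝒴) := ∑ z, ENNReal.ofReal (K z) • Measure.dirac z
  have hμz : ∀ z, μ' {z} = ENNReal.ofReal (K z) := by
    intro z
    simp only [μ', Measure.finsetSum_apply, Measure.smul_apply, smul_eq_mul]
    rw [Finset.sum_eq_single z]
    · rw [Measure.dirac_apply' _ MeasurableSpace.measurableSet_top]; simp
    · intro z' _ h
      rw [Measure.dirac_apply' _ MeasurableSpace.measurableSet_top]; simp [h]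
    · simp
  have hprob : IsProbabilityMeasure μ' := by
    constructor
    simp only [μ', Measure.finsetSum_apply, Measure.smul_apply, smul_eq_mul, measure_univ, mul_one]
    rw [← ENNReal.ofReal_sum_of_nonneg (fun z _ => hK0 z), hK1, ENNReal.ofReal_one]
  have hidm : ∀ c : (𝒮 × 𝒳 × 𝒯) × 𝒴, MeasurableSet ((fun z => z) ⁻¹' {c}) :=
    fun c => MeasurableSpace.measurableSet_top
  have hKid : (fun c => (μ' ((fun z => z) ⁻¹' {c})).toReal) = K := by
    funext z
    change (μ' {z}).toReal = K z
    rw [hμz, ENNReal.toReal_ofReal (hK0 z)]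
  have br : ∀ {δ : Type} [Fintype δ] (f : (𝒮 × 𝒳 × 𝒯) × 𝒴 → δ), ent μ' f = hf K f / Real.log 2 := by
    intro δ _ f
    have := ent_bridge μ' (fun z => z) hidm f
    rw [hKid] at this
    exact this
  refine ⟨(𝒮 × 𝒳 × 𝒯) × 𝒴, mO, μ', 𝒴, hY, mY, fun z => s z.1, fun z => x z.1, fun z => t z.1, fun z => z.2,
    hprob, measurable_from_top, measurable_from_top, measurable_from_top, measurable_from_top, ?_, ?_, ?_, ?_⟩
  · have hm' : Measurable (fun z : (𝒮 × 𝒳 × 𝒯) × 𝒴 => (s z.1, x z.1, t z.1)) := measurable_from_top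
    refine ⟨hZm.aemeasurable, hm'.aemeasurable, ?_⟩
    refine Measure.ext_of_singleton fun c => ?_
    rw [Measure.map_apply hZm (measurableSet_singleton c), Measure.map_apply hm' (measurableSet_singleton c)]
    have h1 := real_bridge μ' (fun z => z) hidm (fun z => (s z.1, x z.1, t z.1)) c
    rw [hKid] at h1
    have h2 : law K (fun z => (s z.1, x z.1, t z.1)) c = P c := by
      unfold law
      rw [Fintype.sum_prod_type, Finset.sum_eq_single c]
      · have : (s c, x c, t c) = c := rfl
        simp only [this, if_true]
        exact hKm c
      · intro c' _ hc
        have : ¬ ((s c', x c', t c') = c) := fun h => hc h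
        simp [this]
      · simp
    rw [h2] at h1
    exact ((ENNReal.toReal_eq_toReal_iff' (measure_ne_top _ _) (measure_ne_top _ _)).1 h1).symm
  · rw [br, br, br, hf_fst P K hKm s, ← add_div, ← sub_div, div_le_iff₀ l2]
    refine hl1.trans (le_of_eq ?_)
    rw [kA, kX, ← hα, ← hβ]; ring
  · rw [br, br, br, hf_fst P K hKm x, ← add_div, ← sub_div, div_le_iff₀ l2]
    refine hl2.trans ?_
    rw [kX]
    have h1 : α * β * (HX * Real.log 2) = α * r * Real.log 2 := by rw [← hβ]; ring
    rw [h1]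
    have := mul_le_of_le_one_left hr0 hα1
    gcongr
  · rw [ge_iff_le, br, br, br, hf_fst P K hKm t]
    have hd : ∀ a b c : ℝ, a / Real.log 2 + b / Real.log 2 - c / Real.log 2
        = (a + b - c) / Real.log 2 := by intro a b c; ring
    refine le_trans ?_ (le_of_eq (hd _ _ _).symm)
    rw [le_div_iff₀ l2]
    refine le_trans ?_ hu
    have ha := util_arith HT HX HA HAT HXT r ε α β hα0 hα1 hβ0 hβ1 hβ hα gI0 gI1 gXT gXT2 gXA gT gA
    refine (mul_le_mul_of_nonneg_right ha l2.le).trans (le_of_eq ?_)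
    have kl : ∀ y : ℝ, Real.log y = Real.logb 2 y * Real.log 2 := by
      intro y; unfold Real.logb; field_simp
    have i0 : (hf P (fun c => (x c, s c)) + hf P t - hf P (fun c => ((x c, s c), t c))) / Real.log 2 = HA + HT - HAT := by
      rw [kA, kT, kAT]; field_simp
    have i1 : (hf P x + hf P t - hf P (fun c => (x c, t c))) / Real.log 2 = HX + HT - HXT := by
      rw [kX, kT, kXT]; field_simp
    rw [i0, i1, kA, kT, kAT, kX, kXT, kl (HA + HT - HAT + 5.51), kl (HX + HT - HXT + 5.51), kl 5.51]
    ring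
end

section
/- Lower bound L′₃^{r,ε} of Theorem 2 (high-leakage regime): Let (S,X,T) be jointly distributed random variables with values in finite sets, let r satisfy 0 ≤ r < min{I(S;X), H(X)}, and let ε satisfy H(S|X) + r ≤ ε < H(S). Then there exists a probability space carrying random variables (S',X',T',Y) such that (S',X',T') has the same joint distribution as (S,X,T), Y takes values in a finite set, I(Y;S') ≤ ε, I(X';Y) ≤ r, and I(Y;T') ≥ H(T|X) − H(X|T) + r. -/
open MeasureTheory ProbabilityTheory

/-- Mass function of `X` under the finite weight `w`. -/
noncomputable def pr {Ω α : Type*} [Fintype Ω] (w : Ω → ℝ) (X : Ω → α) (a : α) : ℝ :=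
  open Classical in ∑ ω, if X ω = a then w ω else 0

lemma pr_group {Ω α : Type*} [Fintype Ω] [Fintype α] (w : Ω → ℝ) (X : Ω → α) (F : α → ℝ) :
    ∑ ω, w ω * F (X ω) = ∑ a, pr w X a * F a := by
  classical
  simp only [pr, Finset.sum_mul]
  rw [Finset.sum_comm]
  refine Finset.sum_congr rfl fun ω _ => ?_
  simp [ite_mul]

lemma pr_nonneg {Ω α : Type*} [Fintype Ω] {w : Ω → ℝ} (hw : ∀ ω, 0 ≤ w ω) (X : Ω → α) (a : α) :
    0 ≤ pr w X a := by
  classical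
  unfold pr
  exact Finset.sum_nonneg fun ω _ => by split_ifs <;> simp [hw]

lemma pr_pos {Ω α : Type*} [Fintype Ω] {w : Ω → ℝ} (hw : ∀ ω, 0 ≤ w ω) (X : Ω → α) (ω : Ω)
    (h : 0 < w ω) : 0 < pr w X (X ω) := by
  classical
  unfold pr
  refine lt_of_lt_of_le h ?_
  refine le_trans (by simp) (Finset.single_le_sum (f := fun ω' => if X ω' = X ω then w ω' else 0)
    (fun i _ => ?_) (Finset.mem_univ ω))
  split_ifs <;> simp [hw]

lemma pr_mono {Ω α β : Type*} [Fintype Ω] {w : Ω → ℝ} (hw : ∀ ω, 0 ≤ w ω) (X : Ω → α) (Z : Ω → β)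
    (a : α) (b : β) (h : ∀ ω, Z ω = b → X ω = a) : pr w Z b ≤ pr w X a := by
  classical
  unfold pr
  refine Finset.sum_le_sum fun ω _ => ?_
  by_cases h1 : Z ω = b
  · simp [h1, h ω h1]
  · simp only [h1, if_false]; split_ifs <;> simp [hw]

lemma pr_sum {Ω α β : Type*} [Fintype Ω] [Fintype β] (w : Ω → ℝ) (X : Ω → α) (Y : Ω → β) (a : α) :
    ∑ b, pr w (fun ω => (Y ω, X ω)) (b, a) = pr w X a := by
  classical
  unfold pr
  rw [Finset.sum_comm]
  refine Finset.sum_congr rfl fun ω _ => ?_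
  simp [Prod.ext_iff, ite_and]

lemma pr_sum' {Ω α β : Type*} [Fintype Ω] [Fintype β] (w : Ω → ℝ) (X : Ω → α) (Y : Ω → β) (a : α) :
    ∑ b, pr w (fun ω => (X ω, Y ω)) (a, b) = pr w X a := by
  classical
  unfold pr
  rw [Finset.sum_comm]
  refine Finset.sum_congr rfl fun ω _ => ?_
  by_cases h : X ω = a <;> simp [h]

lemma pr_total {Ω α : Type*} [Fintype Ω] [Fintype α] (w : Ω → ℝ) (X : Ω → α) :
    ∑ a, pr w X a = ∑ ω, w ω := by
  have := pr_group w X (fun _ => 1)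
  simpa using this.symm

/-- The measure `μ` on a finite space is given by the weights `w`. -/
def IsW {Ω : Type*} [Fintype Ω] [MeasurableSpace Ω] (μ : Measure Ω) (w : Ω → ℝ) : Prop :=
  ∀ (α : Type) (X : Ω → α) (a : α), (μ (X ⁻¹' {a})).toReal = pr w X a

lemma ent_fin {Ω : Type*} {α : Type} [Fintype Ω] [MeasurableSpace Ω] [Fintype α] {μ : Measure Ω}
    {w : Ω → ℝ} (h : IsW μ w) (X : Ω → α) :
    ent μ X = (∑ ω, w ω * (-Real.log (pr w X (X ω)))) / Real.log 2 := by
  rw [pr_group w X (fun a => -Real.log (pr w X a)), Finset.sum_div]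
  unfold ent
  refine Finset.sum_congr rfl fun a _ => ?_
  rw [h α X a, Real.logb]
  ring

lemma ent_mono {Ω : Type*} {α β : Type} [Fintype Ω] [MeasurableSpace Ω] [Fintype α] [Fintype β]
    {μ : Measure Ω} {w : Ω → ℝ} (h : IsW μ w) (hw : ∀ ω, 0 ≤ w ω) (X : Ω → α) (Z : Ω → β)
    (hXZ : ∀ ω ω', Z ω = Z ω' → X ω = X ω') : ent μ X ≤ ent μ Z := by
  rw [ent_fin h, ent_fin h]
  refine div_le_div_of_nonneg_right ?_ (Real.log_nonneg (by norm_num))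
  refine Finset.sum_le_sum fun ω _ => ?_
  rcases (hw ω).eq_or_lt with h0 | h0
  · simp [← h0]
  · refine mul_le_mul_of_nonneg_left ?_ h0.le
    exact neg_le_neg (Real.log_le_log (pr_pos hw Z ω h0)
      (pr_mono hw X Z _ _ fun ω' h' => hXZ _ _ h'))

lemma ent_sub {Ω : Type*} {α β γ : Type} [Fintype Ω] [MeasurableSpace Ω] [Fintype α] [Fintype β]
    [Fintype γ]
    {μ : Measure Ω} {w : Ω → ℝ} (h : IsW μ w) (hw : ∀ ω, 0 ≤ w ω) (h1 : ∑ ω, w ω = 1)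
    (S : Ω → α) (X : Ω → β) (Y : Ω → γ) :
    ent μ S + ent μ (fun ω => (X ω, Y ω)) ≤
      ent μ (fun ω => (Y ω, S ω)) + ent μ (fun ω => (S ω, X ω)) := by
  simp only [ent_fin h, ← add_div]
  refine div_le_div_of_nonneg_right ?_ (Real.log_nonneg (by norm_num))
  simp only [← Finset.sum_add_distrib]
  rw [← sub_nonpos, ← Finset.sum_sub_distrib]
  set pS := pr w S
  set pXY := pr w (fun ω => (X ω, Y ω))
  set pYS := pr w (fun ω => (Y ω, S ω))
  set pSX := pr w (fun ω => (S ω, X ω))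
  let F : α × β × γ → ℝ := fun z =>
    pYS (z.2.2, z.1) * pSX (z.1, z.2.1) / (pS z.1 * pXY (z.2.1, z.2.2))
  let Z : Ω → α × β × γ := fun ω => (S ω, X ω, Y ω)
  have step : ∀ ω, (w ω * -Real.log (pS (S ω)) + w ω * -Real.log (pXY (X ω, Y ω)) -
      (w ω * -Real.log (pYS (Y ω, S ω)) + w ω * -Real.log (pSX (S ω, X ω)))) ≤
      w ω * F (Z ω) - w ω := by
    intro ω
    rcases (hw ω).eq_or_lt with h0 | h0
    · simp [← h0]
    have a1 : 0 < pS (S ω) := pr_pos hw _ ω h0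
    have a2 : 0 < pXY (X ω, Y ω) := pr_pos hw (fun ω => (X ω, Y ω)) ω h0
    have a3 : 0 < pYS (Y ω, S ω) := pr_pos hw (fun ω => (Y ω, S ω)) ω h0
    have a4 : 0 < pSX (S ω, X ω) := pr_pos hw (fun ω => (S ω, X ω)) ω h0
    have hF : 0 < F (Z ω) := by simp only [F, Z]; positivity
    have hl := Real.log_le_sub_one_of_pos hF
    have : Real.log (F (Z ω)) = Real.log (pYS (Y ω, S ω)) + Real.log (pSX (S ω, X ω))
        - (Real.log (pS (S ω)) + Real.log (pXY (X ω, Y ω))) := by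
      simp only [F, Z]
      rw [Real.log_div (by positivity) (by positivity), Real.log_mul a3.ne' a4.ne',
        Real.log_mul a1.ne' a2.ne']
    rw [this] at hl
    have := mul_le_mul_of_nonneg_left hl h0.le
    linarith
  refine (Finset.sum_le_sum fun ω _ => step ω).trans ?_
  rw [Finset.sum_sub_distrib, h1, pr_group w Z F, sub_nonpos]
  have hn : ∀ z, 0 ≤ pr w Z z := fun z => pr_nonneg hw Z z
  have n1 : ∀ z, 0 ≤ pS z := fun z => pr_nonneg hw _ z
  have n2 : ∀ z, 0 ≤ pXY z := fun z => pr_nonneg hw _ z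
  have n3 : ∀ z, 0 ≤ pYS z := fun z => pr_nonneg hw _ z
  have n4 : ∀ z, 0 ≤ pSX z := fun z => pr_nonneg hw _ z
  calc ∑ z, pr w Z z * F z ≤ ∑ z : α × β × γ, pYS (z.2.2, z.1) * pSX (z.1, z.2.1) / pS z.1 := by
        refine Finset.sum_le_sum fun z _ => ?_
        have hle : pr w Z z ≤ pXY (z.2.1, z.2.2) :=
          pr_mono hw _ _ _ _ (by rintro ω rfl; rfl)
        have hle' : pr w Z z / pXY (z.2.1, z.2.2) ≤ 1 := div_le_one_of_le₀ hle (n2 _)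
        have hnn : 0 ≤ pYS (z.2.2, z.1) * pSX (z.1, z.2.1) / pS z.1 :=
          div_nonneg (mul_nonneg (n3 _) (n4 _)) (n1 _)
        calc pr w Z z * F z = (pr w Z z / pXY (z.2.1, z.2.2)) *
              (pYS (z.2.2, z.1) * pSX (z.1, z.2.1) / pS z.1) := by
              simp only [F, div_eq_mul_inv, mul_inv]; ring
          _ ≤ _ := mul_le_of_le_one_left hnn hle'
    _ = ∑ s, pS s * pS s / pS s := by
        rw [Fintype.sum_prod_type]
        refine Finset.sum_congr rfl fun s _ => ?_
        rw [Fintype.sum_prod_type]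
        simp only
        have e1 : ∑ y, pYS (y, s) = pS s := pr_sum w S Y s
        have e2 : ∑ x, pSX (s, x) = pS s := pr_sum' w S X s
        simp only [← Finset.sum_div, ← Finset.sum_mul, e1, ← Finset.mul_sum, e2]
    _ = ∑ s, pS s := Finset.sum_congr rfl fun s _ => by simp
    _ = 1 := by rw [pr_total, h1]
    _ ≤ 1 := le_rfl

lemma disint {A B : Type} [Fintype B] [Nonempty B] (p : A → B → ℝ) (hp : ∀ a b, 0 ≤ p a b) :
    ∃ k : A → B → ℝ, (∀ a b, 0 ≤ k a b) ∧ (∀ a, ∑ b, k a b = 1) ∧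
      ∀ a b, p a b = (∑ b', p a b') * k a b := by
  classical
  obtain ⟨b0⟩ := ‹Nonempty B›
  refine ⟨fun a b => if ∑ b', p a b' = 0 then (if b = b0 then 1 else 0) else
    p a b / ∑ b', p a b', ?_, ?_, ?_⟩
  · intro a b
    dsimp only
    split_ifs
    · exact zero_le_one
    · exact le_rfl
    · exact div_nonneg (hp _ _) (Finset.sum_nonneg fun _ _ => hp _ _)
  · intro a
    by_cases h : ∑ b', p a b' = 0
    · simp [h]
    · simp only [h, if_false, ← Finset.sum_div]
      exact div_self h
  · intro a b
    by_cases h : ∑ b', p a b' = 0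
    · rw [h, zero_mul]
      exact (Finset.sum_eq_zero_iff_of_nonneg fun b _ => hp a b).1 h b (Finset.mem_univ _)
    · simp only [h, if_false]
      field_simp

lemma pi_total {A B : Type} [Fintype A] [DecidableEq A] [Fintype B] (q : A → B → ℝ)
    (hq : ∀ a, ∑ b, q a b = 1) : ∑ f : A → B, ∏ a, q a (f a) = 1 := by
  rw [← Fintype.prod_sum]
  simp [hq]

lemma pi_marg {A B : Type} [Fintype A] [DecidableEq A] [Fintype B] [DecidableEq B] (q : A → B → ℝ)
    (hq : ∀ a, ∑ b, q a b = 1) (x : A) (t : B) :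
    ∑ f : A → B, (if f x = t then ∏ a, q a (f a) else 0) = q x t := by
  have h := Fintype.prod_sum (fun a b => if a = x then (if b = t then q a b else 0) else q a b)
  have e : ∀ f : A → B, (∏ a, if a = x then (if f a = t then q a (f a) else 0) else q a (f a))
      = if f x = t then ∏ a, q a (f a) else 0 := by
    intro f
    split_ifs with hf
    · refine Finset.prod_congr rfl fun a _ => ?_
      by_cases ha : a = x
      · subst ha; simp [hf]
      · simp [ha]
    · exact Finset.prod_eq_zero (Finset.mem_univ x) (by simp [hf])
  simp only [e] at h
  rw [← h, Finset.prod_eq_single x]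
  · simp
  · intro b _ hb
    simp [hb, hq]
  · simp

lemma ent_ident {Ω Ω' α β : Type} [MeasurableSpace Ω] [MeasurableSpace Ω'] [Fintype β]
    [MeasurableSpace α] [MeasurableSpace β] [MeasurableSingletonClass β]
    {μ : Measure Ω} {μ' : Measure Ω'} {Z : Ω → α} {Z' : Ω' → α}
    (h : IdentDistrib Z Z' μ μ') (g : α → β) (hg : Measurable g) :
    ent μ (fun ω => g (Z ω)) = ent μ' (fun ω => g (Z' ω)) := by
  unfold ent
  refine Finset.sum_congr rfl fun a _ => ?_
  have := (h.comp hg).measure_mem_eq (measurableSet_singleton a)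
  have e : μ ((fun ω => g (Z ω)) ⁻¹' {a}) = μ' ((fun ω => g (Z' ω)) ⁻¹' {a}) := this
  rw [e]

/-- Weight of the construction. -/
noncomputable def wt {𝒮 𝒳 𝒯 : Type} [Fintype 𝒳] (pX : 𝒳 → ℝ) (q : 𝒳 → 𝒯 → ℝ)
    (k : 𝒳 × 𝒯 → 𝒮 → ℝ) (α : ℝ) (ω : 𝒮 × 𝒳 × (𝒳 → 𝒯) × Bool) : ℝ :=
  pX ω.2.1 * (∏ x, q x (ω.2.2.1 x)) * k (ω.2.1, ω.2.2.1 ω.2.1) ω.1 *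
    (if ω.2.2.2 then α else 1 - α)

lemma wt_sum {𝒮 𝒳 𝒯 : Type} [Fintype 𝒮] [Fintype 𝒳] [DecidableEq 𝒳] [Fintype 𝒯] (pX : 𝒳 → ℝ)
    (q : 𝒳 → 𝒯 → ℝ)
    (k : 𝒳 × 𝒯 → 𝒮 → ℝ) (α : ℝ) (hk : ∀ z, ∑ s, k z s = 1) (G : 𝒳 → (𝒳 → 𝒯) → Bool → ℝ) :
    ∑ ω, wt pX q k α ω * G ω.2.1 ω.2.2.1 ω.2.2.2 =
    ∑ x, ∑ f : 𝒳 → 𝒯, pX x * (∏ x, q x (f x)) * (α * G x f true + (1 - α) * G x f false) := by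
  rw [Fintype.sum_prod_type, Finset.sum_comm, Fintype.sum_prod_type]
  refine Finset.sum_congr rfl fun x _ => ?_
  rw [Fintype.sum_prod_type]
  refine Finset.sum_congr rfl fun f _ => ?_
  rw [Fintype.sum_bool]
  simp only [wt, if_true, Bool.false_eq_true, if_false]
  rw [← Finset.sum_add_distrib]
  have : ∀ s, pX x * (∏ x, q x (f x)) * k (x, f x) s * α * G x f true +
      pX x * (∏ x, q x (f x)) * k (x, f x) s * (1 - α) * G x f false =
      k (x, f x) s * (pX x * (∏ x, q x (f x)) * (α * G x f true + (1 - α) * G x f false)) := by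
    intro s; ring
  simp only [this, ← Finset.sum_mul, hk, one_mul]

lemma wt_marg {𝒮 𝒳 𝒯 : Type} [Fintype 𝒮] [Fintype 𝒳] [DecidableEq 𝒳] [Fintype 𝒯] (pX : 𝒳 → ℝ)
    (q : 𝒳 → 𝒯 → ℝ) (k : 𝒳 × 𝒯 → 𝒮 → ℝ) (α : ℝ) (hq : ∀ x, ∑ t, q x t = 1) (s : 𝒮) (x : 𝒳) (t : 𝒯) :
    pr (wt pX q k α) (fun ω => (ω.1, ω.2.1, ω.2.2.1 ω.2.1)) (s, x, t) =
      pX x * q x t * k (x, t) s := by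
  classical
  unfold pr
  rw [Fintype.sum_prod_type, Finset.sum_eq_single s]
  rotate_left
  · intro b _ hb; simp [hb]
  · simp
  rw [Fintype.sum_prod_type, Finset.sum_eq_single x]
  rotate_left
  · intro b _ hb; simp [hb]
  · simp
  rw [Fintype.sum_prod_type, ← pi_marg q hq x t, Finset.mul_sum, Finset.sum_mul]
  refine Finset.sum_congr rfl fun f _ => ?_
  rw [Fintype.sum_bool]
  by_cases h : f x = t
  · simp [h, wt]; ring
  · simp [h]

lemma wt_mutInf {𝒮 𝒳 𝒯 : Type} [Fintype 𝒮] [Fintype 𝒳] [DecidableEq 𝒳] [Fintype 𝒯] (pX : 𝒳 → ℝ)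
    (q : 𝒳 → 𝒯 → ℝ) (k : 𝒳 × 𝒯 → 𝒮 → ℝ) (α : ℝ) (hq : ∀ x, ∑ t, q x t = 1)
    (hk : ∀ z, ∑ s, k z s = 1) (hw : ∀ ω, 0 ≤ wt pX q k α ω) (hpX : ∑ x, pX x = 1)
    [MeasurableSpace (𝒮 × 𝒳 × (𝒳 → 𝒯) × Bool)] (μ : Measure (𝒮 × 𝒳 × (𝒳 → 𝒯) × Bool))
    (h : IsW μ (wt pX q k α)) :
    mutInf μ (fun ω => ω.2.1) (fun ω => (ω.2.2.1, if ω.2.2.2 then some ω.2.1 else none)) =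
      α * ent μ (fun ω => ω.2.1) := by
  classical
  have hQ := pi_total q hq
  have hX : ∀ x, pr (wt pX q k α) (fun ω => ω.2.1) x = pX x := by
    intro x
    have := wt_sum pX q k α hk (fun x' _ _ => if x' = x then 1 else 0)
    simp only [mul_ite, mul_one, mul_zero] at this
    refine Eq.trans (Eq.trans (Finset.sum_congr rfl fun _ _ => by congr) this) ?_
    rw [Finset.sum_eq_single x]
    · simp [← Finset.mul_sum, hQ]
    · intro b _ hb; simp [hb]
    · simp
  have hY : ∀ f, pr (wt pX q k α)
      (fun ω => (ω.2.2.1, if ω.2.2.2 then some ω.2.1 else none)) (f, none) =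
      (1 - α) * ∏ x, q x (f x) := by
    intro f
    have := wt_sum pX q k α hk (fun x' f' b' => if f' = f ∧ b' = false then 1 else 0)
    simp only [mul_ite, mul_one, mul_zero] at this
    unfold pr
    simp only [Prod.mk.injEq, ite_eq_right_iff, reduceCtorEq, imp_false, Bool.not_eq_true]
    rw [this]
    simp [← Finset.sum_mul, hpX]
    ring
  have hXY : ∀ x f, pr (wt pX q k α)
      (fun ω => (ω.2.1, (ω.2.2.1, if ω.2.2.2 then some ω.2.1 else none))) (x, (f, none)) =
      pX x * ((1 - α) * ∏ x, q x (f x)) := by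
    intro x f
    have := wt_sum pX q k α hk (fun x' f' b' => if x' = x ∧ f' = f ∧ b' = false then 1 else 0)
    simp only [mul_ite, mul_one, mul_zero] at this
    unfold pr
    simp only [Prod.mk.injEq, ite_eq_right_iff, reduceCtorEq, imp_false, Bool.not_eq_true]
    rw [this, Finset.sum_eq_single x]
    · simp; ring
    · intro b _ hb; simp [hb]
    · simp
  have hXY' : ∀ x f, pr (wt pX q k α)
      (fun ω => (ω.2.1, (ω.2.2.1, if ω.2.2.2 then some ω.2.1 else none))) (x, (f, some x)) =
      pr (wt pX q k α)
      (fun ω => (ω.2.2.1, if ω.2.2.2 then some ω.2.1 else none)) (f, some x) := by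
    intro x f
    apply le_antisymm
    · exact pr_mono hw _ _ _ _ (by rintro ω h'; simp at h'; simp [h'])
    · exact pr_mono hw _ _ _ _ (by rintro ω h'; simp at h'; simp [h'])
  unfold mutInf
  rw [ent_fin h, ent_fin h, ent_fin h, ← add_div, ← sub_div, ← mul_div_assoc]
  congr 1
  rw [← Finset.sum_add_distrib, ← Finset.sum_sub_distrib]
  trans ∑ ω, wt pX q k α ω * (if ω.2.2.2 = true then -Real.log (pX ω.2.1) else 0)
  · refine Finset.sum_congr rfl fun ω _ => ?_
    obtain ⟨s, x, f, b⟩ := ω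
    rcases (hw (s, x, f, b)).eq_or_lt with h0 | h0
    · simp [← h0]
    have a1 := pr_pos hw (fun ω => ω.2.1) _ h0
    have a2 := pr_pos hw (fun ω => (ω.2.2.1, if ω.2.2.2 then some ω.2.1 else none)) _ h0
    cases b
    · simp only [Bool.false_eq_true, if_false, hX, hY, hXY] at a1 a2 ⊢
      rw [Real.log_mul a1.ne' a2.ne']
      ring
    · simp only [if_true, hX, hXY']
      ring
  · rw [wt_sum pX q k α hk (fun x f b => if b = true then -Real.log (pX x) else 0)]
    simp only [hX]
    rw [wt_sum pX q k α hk (fun x f b => -Real.log (pX x)), Finset.mul_sum]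
    refine Finset.sum_congr rfl fun x _ => ?_
    rw [Finset.mul_sum]
    refine Finset.sum_congr rfl fun f _ => ?_
    simp only [if_true, Bool.false_eq_true, if_false]
    ring

lemma exists_measure {Ω : Type} [Fintype Ω] (w : Ω → ℝ) (hw : ∀ ω, 0 ≤ w ω) (h1 : ∑ ω, w ω = 1) :
    ∃ μ : @Measure Ω ⊤, @IsProbabilityMeasure Ω ⊤ μ ∧ @IsW Ω _ ⊤ μ w := by
  classical
  letI : MeasurableSpace Ω := ⊤
  let p : PMF Ω := PMF.ofFintype (fun ω => ENNReal.ofReal (w ω)) (by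
    rw [← ENNReal.ofReal_sum_of_nonneg fun i _ => hw i, h1, ENNReal.ofReal_one])
  refine ⟨p.toMeasure, inferInstance, ?_⟩
  intro α X a
  rw [PMF.toMeasure_apply_fintype, ENNReal.toReal_sum]
  · unfold pr
    refine Finset.sum_congr rfl fun ω _ => ?_
    by_cases h : X ω = a
    · simp [Set.indicator, h, p, hw]
    · simp [Set.indicator, h]
  · intro ω _
    by_cases h : X ω = a
    · simp [Set.indicator, h, p]
    · simp [Set.indicator, h]

/-- **Lower bound `L′₃^{r,ε}` of Theorem 2 (high-leakage regime).** For `0 ≤ r < min{I(S;X), H(X)}` and `H(S|X) + r ≤ ε < H(S)` there is a representation `Y` with `I(Y;S') ≤ ε`, `I(X';Y) ≤ r`, and `I(Y;T') ≥ H(T|X) − H(X|T) + r`. -/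
theorem lower_bound_L3re_prime
    {Ω 𝒮 𝒳 𝒯 : Type} [MeasurableSpace Ω] (μ : Measure Ω) [IsProbabilityMeasure μ]
    [Fintype 𝒮] [MeasurableSpace 𝒮] [MeasurableSingletonClass 𝒮]
    [Fintype 𝒳] [MeasurableSpace 𝒳] [MeasurableSingletonClass 𝒳]
    [Fintype 𝒯] [MeasurableSpace 𝒯] [MeasurableSingletonClass 𝒯]
    (S : Ω → 𝒮) (X : Ω → 𝒳) (T : Ω → 𝒯)
    (hS : Measurable S) (hX : Measurable X) (hT : Measurable T)
    (r : ℝ) (hr0 : 0 ≤ r) (hr1 : r < min (mutInf μ S X) (ent μ X))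
    (ε : ℝ) (hε0 : condEnt μ S X + r ≤ ε) (hε1 : ε < ent μ S) :
    ∃ (Ω' : Type) (_ : MeasurableSpace Ω') (μ' : Measure Ω')
      (𝒴 : Type) (_ : Fintype 𝒴) (_ : MeasurableSpace 𝒴)
      (S' : Ω' → 𝒮) (X' : Ω' → 𝒳) (T' : Ω' → 𝒯) (Y : Ω' → 𝒴),
      IsProbabilityMeasure μ' ∧
      Measurable S' ∧ Measurable X' ∧ Measurable T' ∧ Measurable Y ∧
      IdentDistrib (fun ω => (S ω, X ω, T ω)) (fun ω => (S' ω, X' ω, T' ω)) μ μ' ∧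
      mutInf μ' Y S' ≤ ε ∧ mutInf μ' X' Y ≤ r ∧
      mutInf μ' Y T' ≥ condEnt μ T X - condEnt μ X T + r := by
  classical
  set Z : Ω → 𝒮 × 𝒳 × 𝒯 := fun ω => (S ω, X ω, T ω) with hZdef
  have hZ : Measurable Z := hS.prodMk (hX.prodMk hT)
  have hrX : r < ent μ X := lt_of_lt_of_le hr1 (min_le_right _ _)
  have hpos : 0 < ent μ X := hr0.trans_lt hrX
  have hne : Nonempty Ω := by
    by_contra hcon
    rw [not_nonempty_iff] at hcon
    have := measure_univ (μ := μ)
    simp [Set.univ_eq_empty_iff.2 hcon] at this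
  obtain ⟨ω0⟩ := hne
  haveI : Nonempty 𝒮 := ⟨S ω0⟩
  haveI : Nonempty 𝒯 := ⟨T ω0⟩
  let P : 𝒮 → 𝒳 → 𝒯 → ℝ := fun s x t => (μ (Z ⁻¹' {(s, x, t)})).toReal
  have hP : ∀ s x t, 0 ≤ P s x t := fun _ _ _ => ENNReal.toReal_nonneg
  have hPsum : ∑ x, ∑ t, ∑ s, P s x t = 1 := by
    have e : ∑ z : 𝒮 × 𝒳 × 𝒯, (μ (Z ⁻¹' {z})).toReal = 1 := by
      have h1 := sum_measure_preimage_singleton (μ := μ) (Finset.univ : Finset (𝒮 × 𝒳 × 𝒯))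
        (f := Z) (fun y _ => hZ (measurableSet_singleton y))
      rw [← ENNReal.toReal_sum (fun _ _ => measure_ne_top _ _), h1]
      simp
    rw [Fintype.sum_prod_type, Finset.sum_comm] at e
    rw [← e, Fintype.sum_prod_type]
  obtain ⟨k, hk0, hk1, hk⟩ := disint (fun (z : 𝒳 × 𝒯) s => P s z.1 z.2) (fun _ _ => hP _ _ _)
  obtain ⟨q, hq0, hq1, hq⟩ := disint (fun x t => ∑ s, P s x t)
    (fun x t => Finset.sum_nonneg fun _ _ => hP _ _ _)
  let pX : 𝒳 → ℝ := fun x => ∑ t, ∑ s, P s x t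
  have hpX0 : ∀ x, 0 ≤ pX x := fun x =>
    Finset.sum_nonneg fun _ _ => Finset.sum_nonneg fun _ _ => hP _ _ _
  have hPk : ∀ s x t, P s x t = pX x * q x t * k (x, t) s := by
    intro s x t
    rw [← hq x t]
    exact hk (x, t) s
  let α : ℝ := r / ent μ X
  have hα0 : 0 ≤ α := div_nonneg hr0 hpos.le
  have hα1 : α ≤ 1 := div_le_one_of_le₀ hrX.le hpos.le
  let w := wt pX q k α
  have hw : ∀ ω, 0 ≤ w ω := by
    intro ω
    refine mul_nonneg (mul_nonneg (mul_nonneg (hpX0 _) (Finset.prod_nonneg fun _ _ => hq0 _ _))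
      (hk0 _ _)) ?_
    split_ifs <;> linarith
  have hw1 : ∑ ω, w ω = 1 := by
    have := wt_sum pX q k α hk1 (fun _ _ _ => 1)
    simp only [mul_one, add_sub_cancel] at this
    simp only [w, this, ← Finset.mul_sum, pi_total q hq1, mul_one]
    exact hPsum
  obtain ⟨μ', hμ', hW⟩ := exists_measure w hw hw1
  letI : MeasurableSpace (𝒮 × 𝒳 × (𝒳 → 𝒯) × Bool) := ⊤
  have hid : IdentDistrib Z (fun ω => (ω.1, ω.2.1, ω.2.2.1 ω.2.1)) μ μ' := by
    refine ⟨hZ.aemeasurable, measurable_from_top.aemeasurable, ?_⟩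
    refine Measure.ext_of_singleton fun z => ?_
    rw [Measure.map_apply hZ (measurableSet_singleton _),
      Measure.map_apply measurable_from_top (measurableSet_singleton _)]
    rw [← ENNReal.toReal_eq_toReal_iff' (measure_ne_top _ _) (measure_ne_top _ _)]
    obtain ⟨s, x, t⟩ := z
    rw [hW _ _ _, wt_marg pX q k α hq1 s x t, ← hPk s x t]
  have eX : ent μ X = ent μ' (fun ω => ω.2.1) :=
    ent_ident hid (fun z => z.2.1) (by fun_prop)
  have eT : ent μ T = ent μ' (fun ω => ω.2.2.1 ω.2.1) :=
    ent_ident hid (fun z => z.2.2) (by fun_prop)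
  have eSX : ent μ (fun ω => (S ω, X ω)) = ent μ' (fun ω => (ω.1, ω.2.1)) :=
    ent_ident hid (fun z => (z.1, z.2.1)) (by fun_prop)
  have eTX : ent μ (fun ω => (T ω, X ω)) = ent μ' (fun ω => (ω.2.2.1 ω.2.1, ω.2.1)) :=
    ent_ident hid (fun z => (z.2.2, z.2.1)) (by fun_prop)
  have eXT : ent μ (fun ω => (X ω, T ω)) = ent μ' (fun ω => (ω.2.1, ω.2.2.1 ω.2.1)) :=
    ent_ident hid (fun z => (z.2.1, z.2.2)) (by fun_prop)
  have hTX : ent μ' (fun ω : 𝒮 × 𝒳 × (𝒳 → 𝒯) × Bool => (ω.2.1, ω.2.2.1 ω.2.1)) =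
      ent μ' (fun ω => (ω.2.2.1 ω.2.1, ω.2.1)) := by
    apply le_antisymm
    · exact ent_mono hW hw _ _ (by intro a b h; simp only [Prod.mk.injEq] at h ⊢; exact h.symm)
    · exact ent_mono hW hw _ _ (by intro a b h; simp only [Prod.mk.injEq] at h ⊢; exact h.symm)
  have hI := wt_mutInf pX q k α hq1 hk1 hw hPsum μ' hW
  rw [← eX, div_mul_cancel₀ _ hpos.ne'] at hI
  letI : MeasurableSpace ((𝒳 → 𝒯) × Option 𝒳) := ⊤
  refine ⟨𝒮 × 𝒳 × (𝒳 → 𝒯) × Bool, ⊤, μ', (𝒳 → 𝒯) × Option 𝒳, inferInstance, ⊤, fun ω => ω.1,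
    fun ω => ω.2.1, fun ω => ω.2.2.1 ω.2.1,
    fun ω => (ω.2.2.1, if ω.2.2.2 then some ω.2.1 else none), hμ', measurable_from_top,
    measurable_from_top, measurable_from_top, measurable_from_top, hid, ?_, hI.le, ?_⟩
  · have h2 := ent_sub hW hw hw1 (fun ω => ω.1) (fun ω => ω.2.1)
      (fun ω => (ω.2.2.1, if ω.2.2.2 then some ω.2.1 else none))
    unfold mutInf at hI ⊢
    unfold condEnt at hε0
    linarith
  · have h3 := ent_mono hW hw
      (fun ω => ((ω.2.2.1, if ω.2.2.2 then some ω.2.1 else none), ω.2.2.1 ω.2.1))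
      (fun ω => (ω.2.1, (ω.2.2.1, if ω.2.2.2 then some ω.2.1 else none))) (by
        intro a b h
        simp only [Prod.mk.injEq] at h ⊢
        obtain ⟨h1, h2, h3⟩ := h
        exact ⟨⟨h2, h3⟩, by rw [h1, h2]⟩)
    unfold mutInf at hI ⊢
    unfold condEnt
    linarith
end
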